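/- arXiv:2508.06622 — 9 statements merged into one kernel-verified Lean document; each statement's English description precedes it below -/
import Mathlib

section
/- Under the following assumptions there exists δ ∈ (0,∞) such that inf_{θ∈Θ} inf_{Q : D_f(Q‖P_T) ≤ δ} E_Q[ℒ_θ] = 0, and θ_* is a minimizer (i.e. the relaxed optimization problem is solved by the exact non-noisy classifier h_{θ_*} = h_*): (1) inf_{x∈𝒳} T^x_{h_*(x),h_*(x)} > 0; (2) there is a classifier family h_θ : 𝒳 → 𝒫(𝒴), θ ∈ Θ, where 𝒫(𝒴) is the space of probability vectors over the labels, and there exists θ_* ∈ Θ with h_{θ_*} = h_* (identifying each label with its one-hot vector); (3) the loss L : 𝒫(𝒴) × 𝒴 → [0,∞] satisfies L(p,y) = 0 if and only if p = y, and ℒ_θ(x,y) := L(h_θ(x), y); (4) f : (0,∞) → ℝ is convex with f(1) = 0 and f(0) := lim_{t→0+} f(t) is finite. -/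
open MeasureTheory Classical
open scoped ENNReal BigOperators

/-- The `f`-divergence `D_f(Q ‖ P) = E_P[f(dQ/dP)]` when `Q ≪ P` (and the integrand is
integrable), and `∞` otherwise, valued in the extended reals. -/
noncomputable def fDiv {Ω : Type*} [MeasurableSpace Ω] (f : ℝ → ℝ) (Q P : Measure Ω) : EReal :=
  if Q ≪ P ∧ Integrable (fun ω => f ((Q.rnDeriv P) ω).toReal) P
  then ((∫ ω, f ((Q.rnDeriv P) ω).toReal ∂P : ℝ) : EReal)
  else ⊤

/-- Under the stated assumptions there exists `δ ∈ (0,∞)` such that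
`inf_θ inf_{Q : D_f(Q‖P_T) ≤ δ} E_Q[ℒ_θ] = 0`, and `θ⋆` (with `h_{θ⋆} = h⋆`) is a minimizer. -/
theorem exact_labels_solve_relaxed_problem
    {𝒳 : Type*} [MeasurableSpace 𝒳]
    {𝒴 : Type*} [Fintype 𝒴] [MeasurableSpace 𝒴] [MeasurableSingletonClass 𝒴]
    (PX : Measure 𝒳) [IsProbabilityMeasure PX]
    (hstar : 𝒳 → 𝒴) (hstar_meas : Measurable hstar)
    -- sample-dependent transition matrix
    (T : 𝒳 → 𝒴 → 𝒴 → ℝ)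
    (hT_meas : ∀ y ytilde : 𝒴, Measurable fun x => T x y ytilde)
    (hT_nonneg : ∀ x y ytilde, 0 ≤ T x y ytilde)
    (hT_sum : ∀ x y, ∑ ytilde : 𝒴, T x y ytilde = 1)
    -- the noisy-label distribution P_T
    (PT : Measure (𝒳 × 𝒴)) [IsProbabilityMeasure PT]
    (hPT : ∀ (A : Set 𝒳) (y : 𝒴), MeasurableSet A →
      PT (A ×ˢ ({y} : Set 𝒴)) = ∫⁻ x in A, ENNReal.ofReal (T x (hstar x) y) ∂PX)
    -- (1) inf_x T^x_{h⋆(x),h⋆(x)} > 0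
    (hTpos : ∃ c : ℝ, 0 < c ∧ ∀ x, c ≤ T x (hstar x) (hstar x))
    -- (2) classifier family valued in probability vectors, containing the exact labels
    {Θ : Type*} (hθ : Θ → 𝒳 → 𝒴 → ℝ)
    (hθ_nonneg : ∀ θ x y, 0 ≤ hθ θ x y)
    (hθ_sum : ∀ θ x, ∑ y : 𝒴, hθ θ x y = 1)
    (θs : Θ)
    (hθs : ∀ x, hθ θs x = fun y => if y = hstar x then (1 : ℝ) else 0)
    -- (3) the loss function, vanishing exactly on one-hot matches
    (L : (𝒴 → ℝ) → 𝒴 → ℝ≥0∞)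
    (hL : ∀ (p : 𝒴 → ℝ) (y : 𝒴), L p y = 0 ↔ p = fun y' => if y' = y then (1 : ℝ) else 0)
    -- (4) convex f with f(1) = 0 and finite continuous extension at 0
    (f : ℝ → ℝ) (hf_cvx : ConvexOn ℝ (Set.Ioi (0 : ℝ)) f) (hf1 : f 1 = 0)
    (hf0 : ContinuousWithinAt f (Set.Ioi (0 : ℝ)) 0) :
    ∃ δ : ℝ, 0 < δ ∧
      (⨅ θ : Θ, ⨅ Q : {Q : Measure (𝒳 × 𝒴) //
          IsProbabilityMeasure Q ∧ fDiv f Q PT ≤ (δ : EReal)},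
        ∫⁻ p, L (hθ θ p.1) p.2 ∂(Q : Measure (𝒳 × 𝒴))) = 0 ∧
      (⨅ Q : {Q : Measure (𝒳 × 𝒴) //
          IsProbabilityMeasure Q ∧ fDiv f Q PT ≤ (δ : EReal)},
        ∫⁻ p, L (hθ θs p.1) p.2 ∂(Q : Measure (𝒳 × 𝒴))) = 0 := by
  set S : Set (𝒳 × 𝒴) := ⋃ y : 𝒴, (hstar ⁻¹' {y}) ×ˢ ({y} : Set 𝒴) with hS
  have hSm : MeasurableSet S :=
    MeasurableSet.iUnion fun y => (hstar_meas (measurableSet_singleton y)).prod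
      (measurableSet_singleton y)
  have hmem : ∀ p ∈ S, p.2 = hstar p.1 := by
    intro p hp
    simp only [hS, Set.mem_iUnion, Set.mem_prod, Set.mem_preimage, Set.mem_singleton_iff] at hp
    obtain ⟨y, h1, h2⟩ := hp
    rw [h1, h2]
  obtain ⟨c, hc, hcT⟩ := hTpos
  have hS0 : PT S ≠ 0 := by
    intro h0
    have hy : ∀ y, PX (hstar ⁻¹' {y}) = 0 := by
      intro y
      have h1 : PT ((hstar ⁻¹' {y}) ×ˢ ({y} : Set 𝒴)) = 0 :=
        measure_mono_null (Set.subset_iUnion (fun y : 𝒴 => (hstar ⁻¹' {y}) ×ˢ ({y} : Set 𝒴)) y) h0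
      have hm := hstar_meas (measurableSet_singleton y)
      rw [hPT _ _ hm] at h1
      have h2 : ∫⁻ x in hstar ⁻¹' {y}, ENNReal.ofReal c ∂PX ≤ 0 := by
        rw [← h1]
        refine setLIntegral_mono' hm ?_
        intro x hx
        have hx' : hstar x = y := hx
        have := hcT x
        rw [hx'] at this ⊢
        exact ENNReal.ofReal_le_ofReal this
      rw [setLIntegral_const] at h2
      have h3 := mul_eq_zero.mp (le_antisymm h2 bot_le)
      rcases h3 with h3 | h3
      · exact absurd (ENNReal.ofReal_eq_zero.mp h3) (not_le.mpr hc)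
      · exact h3
    have hu : PX Set.univ = 0 := by
      have : (Set.univ : Set 𝒳) = ⋃ y : 𝒴, hstar ⁻¹' {y} := by
        ext x; simp
      rw [this]
      exact measure_iUnion_null hy
    simp at hu
  set Q : Measure (𝒳 × 𝒴) := ProbabilityTheory.cond PT S with hQ
  have hQp : IsProbabilityMeasure Q := ProbabilityTheory.cond_isProbabilityMeasure hS0
  have hQd : Q = PT.withDensity (S.indicator fun _ => (PT S)⁻¹) := by
    rw [withDensity_indicator hSm, withDensity_const, hQ, ProbabilityTheory.cond]
  have hr : Q.rnDeriv PT =ᵐ[PT] S.indicator fun _ => (PT S)⁻¹ := by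
    rw [hQd]
    exact Measure.rnDeriv_withDensity _ (measurable_const.indicator hSm)
  have hac : Q ≪ PT := by
    rw [hQd]; exact withDensity_absolutelyContinuous _ _
  have hint : Integrable (fun ω => f ((Q.rnDeriv PT) ω).toReal) PT := by
    have h1 : Integrable (fun ω => S.indicator (fun _ => f ((PT S)⁻¹).toReal) ω
        + Sᶜ.indicator (fun _ => f 0) ω) PT :=
      ((integrable_const _).indicator hSm).add ((integrable_const _).indicator hSm.compl)
    refine h1.congr ?_
    filter_upwards [hr] with ω hω
    rw [hω]
    by_cases h : ω ∈ S <;> simp [h]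
  have hloss : ∫⁻ p, L (hθ θs p.1) p.2 ∂Q = 0 := by
    have : (fun p : 𝒳 × 𝒴 => L (hθ θs p.1) p.2) =ᵐ[Q] fun _ => 0 := by
      filter_upwards [ProbabilityTheory.ae_cond_mem hSm] with p hp
      rw [hL, hθs, hmem p hp]
    rw [lintegral_congr_ae this, lintegral_zero]
  set D := ∫ ω, f ((Q.rnDeriv PT) ω).toReal ∂PT with hD
  have hdiv : fDiv f Q PT ≤ ((max D 0 + 1 : ℝ) : EReal) := by
    rw [fDiv, if_pos ⟨hac, hint⟩]
    exact EReal.coe_le_coe_iff.mpr (by linarith [le_max_left D 0])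
  have key : (⨅ Q : {Q : Measure (𝒳 × 𝒴) //
          IsProbabilityMeasure Q ∧ fDiv f Q PT ≤ ((max D 0 + 1 : ℝ) : EReal)},
        ∫⁻ p, L (hθ θs p.1) p.2 ∂(Q : Measure (𝒳 × 𝒴))) = 0 :=
    le_antisymm ((iInf_le _ ⟨Q, hQp, hdiv⟩).trans hloss.le) bot_le
  exact ⟨max D 0 + 1, by linarith [le_max_right D 0],
    le_antisymm ((iInf_le _ θs).trans key.le) bot_le, key⟩
end

section
/- Let 𝒳 be a complete separable metric space with its Borel σ-algebra. Suppose: (1) there is r ∈ (0,1) such that T^x_{h_*(x),h_*(x)} = 1 − r for all x ∈ 𝒳, and T^x_{h_*(x),y} < 1 − r for all x ∈ 𝒳 and y ∈ 𝒴 with y ≠ h_*(x); (2) there is a classifier family h_θ : 𝒳 → 𝒫(𝒴), θ ∈ Θ, where 𝒫(𝒴) is the space of probability vectors over the labels, and there exists θ_* ∈ Θ with h_{θ_*} = h_* (identifying each label with its one-hot vector); (3) the loss L : 𝒫(𝒴) × 𝒴 → [0,∞] satisfies L(p,y) = 0 if and only if p = y; (4) equipping 𝒴 with the discrete metric, ℒ_θ(x,y)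 := L(h_θ(x), y) is lower semicontinuous on 𝒳 × 𝒴 for each θ ∈ Θ; (5) f : (0,∞) → ℝ is strictly convex with f(1) = 0, f(0) := lim_{t→0+} f(t) finite, and f*(y) finite for all y ∈ ℝ. Define δ := r f(0) + (1 − r) f(1/(1 − r)). Then every θ̃ ∈ argmin_{θ∈Θ} inf_{Q : D_f(Q‖P_T) ≤ δ} E_Q[ℒ_θ] satisfies h_{θ̃} = h_* almost surely under P_𝒳. -/
open MeasureTheory Classical
open scoped ENNReal BigOperators

open Filter Topology Set in
lemma aux_cont (f : ℝ → ℝ) (hf_cvx : StrictConvexOn ℝ (Set.Ioi (0 : ℝ)) f)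
    (hf0 : ContinuousWithinAt f (Set.Ioi (0 : ℝ)) 0) : ContinuousOn f (Set.Ici 0) := by
  intro x hx
  rcases eq_or_lt_of_le (show (0:ℝ) ≤ x from hx) with h | h
  · subst h
    rw [← Set.Ioi_insert, continuousWithinAt_insert_self]
    exact hf0
  · exact ((hf_cvx.convexOn.continuousOn isOpen_Ioi).continuousAt
      (isOpen_Ioi.mem_nhds h)).continuousWithinAt

open Filter Topology Set in
lemma aux_conv (f : ℝ → ℝ) (hf_cvx : StrictConvexOn ℝ (Set.Ioi (0 : ℝ)) f)
    (hf0 : ContinuousWithinAt f (Set.Ioi (0 : ℝ)) 0) : ConvexOn ℝ (Set.Ici 0) f := by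
  have hc := aux_cont f hf_cvx hf0
  have key : ∀ x : ℝ, 0 ≤ x → Tendsto (fun e : ℝ => f (x + e)) (𝓝[>] 0) (𝓝 (f x)) := by
    intro x hx
    refine (hc x hx).tendsto.comp ?_
    refine tendsto_nhdsWithin_iff.2 ⟨?_, ?_⟩
    · have : Tendsto (fun e : ℝ => x + e) (𝓝 0) (𝓝 (x + 0)) :=
        (continuous_const.add continuous_id).tendsto 0
      rw [add_zero] at this
      exact this.mono_left nhdsWithin_le_nhds
    · filter_upwards [self_mem_nhdsWithin] with e he
      have : 0 < e := he
      exact (by linarith : (0:ℝ) ≤ x + e)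
  refine ⟨convex_Ici 0, ?_⟩
  intro x hx y hy a b ha hb hab
  have hx' : (0:ℝ) ≤ x := hx
  have hy' : (0:ℝ) ≤ y := hy
  refine le_of_tendsto_of_tendsto (key _ (by simp only [smul_eq_mul]; positivity))
    (((key x hx).const_smul a).add ((key y hy).const_smul b)) ?_
  filter_upwards [self_mem_nhdsWithin] with e he
  have he' : 0 < e := he
  have := hf_cvx.convexOn.2 (show x + e ∈ Ioi (0:ℝ) by simp; linarith)
    (show y + e ∈ Ioi (0:ℝ) by simp; linarith) ha hb hab
  convert this using 2
  simp only [smul_eq_mul]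
  linear_combination (-e) * hab

lemma aux_mono (f : ℝ → ℝ) (hf_cvx : StrictConvexOn ℝ (Set.Ioi (0 : ℝ)) f)
    (hf0 : ContinuousWithinAt f (Set.Ioi (0 : ℝ)) 0) (p q : ℝ) (hp : 0 < p) (hpq : p < q) :
    (1 - q) * f 0 + q * f (1 / q) < (1 - p) * f 0 + p * f (1 / p) := by
  have hc := aux_conv f hf_cvx hf0
  have hq : 0 < q := hp.trans hpq
  -- w = 1/(2q), v = 1/p, u = 1/q
  have h2 : p / (2 * q) < 1 := by rw [div_lt_one (by positivity)]; linarith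
  have h2' : 0 < p / (2 * q) := by positivity
  have e1 := hc.2 (show (0:ℝ) ∈ Set.Ici 0 by simp) (show 1 / p ∈ Set.Ici (0:ℝ) by
    simp only [Set.mem_Ici]; positivity)
    (show 0 ≤ 1 - p / (2 * q) by linarith) h2'.le (by ring)
  have hne : 1 / (2 * q) < 1 / p := by
    apply one_div_lt_one_div_of_lt hp; linarith
  set l : ℝ := 2 * (q - p) / (2 * q - p) with hl
  have hd : 0 < 2 * q - p := by linarith
  have l0 : 0 < l := div_pos (by linarith) hd
  have l1 : l < 1 := by rw [hl, div_lt_one hd]; linarith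
  have e2 := hf_cvx.2 (show 1 / (2 * q) ∈ Set.Ioi (0:ℝ) by
    simp only [Set.mem_Ioi]; positivity) (show 1 / p ∈ Set.Ioi (0:ℝ) by
    simp only [Set.mem_Ioi]; positivity) hne.ne l0 (show 0 < 1 - l by linarith) (by ring)
  simp only [smul_eq_mul, mul_zero, zero_add] at e1 e2
  have a1 : p / (2 * q) * (1 / p) = 1 / (2 * q) := by field_simp
  have hd2 : 2 * q - p ≠ 0 := hd.ne'
  have a2 : l * (1 / (2 * q)) + (1 - l) * (1 / p) = 1 / q := by
    rw [hl]; field_simp; ring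
  rw [a1] at e1
  rw [a2] at e2
  have e3 : f (1 / q) < l * ((1 - p / (2 * q)) * f 0 + p / (2 * q) * f (1 / p))
      + (1 - l) * f (1 / p) := by
    have := mul_le_mul_of_nonneg_left e1 l0.le
    linarith
  have e4 := mul_lt_mul_of_pos_left e3 hq
  have e5 : q * (l * ((1 - p / (2 * q)) * f 0 + p / (2 * q) * f (1 / p))
      + (1 - l) * f (1 / p)) = (q - p) * f 0 + p * f (1 / p) := by
    have b1 : l * (2 * q - p) = 2 * (q - p) := by rw [hl]; exact div_mul_cancel₀ _ hd2
    have b2 : q * (p / (2 * q)) = p / 2 := by field_simp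
    linear_combination (f 0 / 2 - f (1 / p) / 2) * b1 + (l * f (1 / p) - l * f 0) * b2
  linarith

lemma aux_jensen {Ω : Type*} [MeasurableSpace Ω] (f : ℝ → ℝ)
    (hc : ContinuousOn f (Set.Ici 0)) (hv : ConvexOn ℝ (Set.Ici 0) f)
    (P Q : Measure Ω) [IsProbabilityMeasure P] [IsProbabilityMeasure Q] (hQP : Q ≪ P)
    (hi : Integrable (fun ω => f ((Q.rnDeriv P) ω).toReal) P) (B : Set Ω)
    (hB : 0 < P.real B) :
    P.real B * f (Q.real B / P.real B) ≤ ∫ ω in B, f ((Q.rnDeriv P) ω).toReal ∂P := by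
  have hB0 : P B ≠ 0 := by
    intro h; simp [measureReal_def, h] at hB
  have := hv.map_set_average_le hc isClosed_Ici (μ := P) (t := B)
    (f := fun ω => ((Q.rnDeriv P) ω).toReal) hB0 (measure_ne_top _ _)
    (Filter.Eventually.of_forall fun x => ENNReal.toReal_nonneg)
    (Measure.integrable_toReal_rnDeriv).integrableOn hi.integrableOn
  rw [setAverage_eq, setAverage_eq, Measure.setIntegral_toReal_rnDeriv hQP, smul_eq_mul,
    smul_eq_mul, inv_mul_eq_div, inv_mul_eq_div, le_div_iff₀ hB] at this
  linarith

open Filter Topology in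
lemma aux_key {Ω : Type*} [MeasurableSpace Ω] (f : ℝ → ℝ)
    (hf_cvx : StrictConvexOn ℝ (Set.Ioi (0 : ℝ)) f)
    (hf0 : ContinuousWithinAt f (Set.Ioi (0 : ℝ)) 0)
    (P : Measure Ω) [IsProbabilityMeasure P] (r : ℝ) (hr0 : 0 < r) (hr1 : r < 1)
    (l : Ω → ℝ≥0∞) (hl : Measurable l)
    (hQ : ∀ κ : ℝ≥0∞, 0 < κ → ∃ Q : Measure Ω, IsProbabilityMeasure Q ∧
      fDiv f Q P ≤ ((r * f 0 + (1 - r) * f (1 / (1 - r)) : ℝ) : EReal) ∧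
      ∫⁻ p, l p ∂Q < κ) :
    ENNReal.ofReal (1 - r) ≤ P {p | l p = 0} := by
  by_contra hcon
  push Not at hcon
  have hc := aux_cont f hf_cvx hf0
  have hv := aux_conv f hf_cvx hf0
  have hset : {p | l p = 0} = ⋂ n : ℕ, {p | l p < ((n : ℝ≥0∞) + 1)⁻¹} := by
    ext p
    simp only [Set.mem_setOf_eq, Set.mem_iInter]
    constructor
    · intro h n; rw [h]; simp
    · intro h
      by_contra h0
      obtain ⟨n, hn⟩ := ENNReal.exists_inv_nat_lt h0
      have h1 := h n
      have : ((n : ℝ≥0∞) + 1)⁻¹ ≤ (n : ℝ≥0∞)⁻¹ := ENNReal.inv_le_inv.2 le_self_add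
      exact absurd (h1.trans_le this) (not_lt.2 hn.le)
  have hms : ∀ n : ℕ, MeasurableSet {p | l p < ((n : ℝ≥0∞) + 1)⁻¹} :=
    fun n => measurableSet_lt hl measurable_const
  have hlim := tendsto_measure_iInter_atTop (μ := P)
    (s := fun n : ℕ => {p | l p < ((n : ℝ≥0∞) + 1)⁻¹})
    (fun n => (hms n).nullMeasurableSet)
    (by
      intro m n hmn p hp
      simp only [Set.mem_setOf_eq] at hp ⊢
      refine hp.trans_le (ENNReal.inv_le_inv.2 ?_)
      gcongr) ⟨0, measure_ne_top _ _⟩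
  rw [← hset] at hlim
  obtain ⟨n, hn⟩ := (hlim.eventually (gt_mem_nhds hcon)).exists
  simp only [Function.comp] at hn
  set ε : ℝ≥0∞ := ((n : ℝ≥0∞) + 1)⁻¹ with hε
  have hε0 : ε ≠ 0 := by simp [hε]
  have hεt : ε ≠ ∞ := by simp [hε]
  set B : Set Ω := {p | l p < ε} with hBdef
  have hB : MeasurableSet B := hms n
  have hBr : P.real B < 1 - r := by
    rw [measureReal_def]
    exact (ENNReal.lt_ofReal_iff_toReal_lt (measure_ne_top _ _)).1 hn
  have hBc : P.real Bᶜ = 1 - P.real B := probReal_compl_eq_one_sub hB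
  -- threshold
  have hη : ∃ η : ℝ, 0 < η ∧ η ≤ 1 ∧ (0 < P.real B → ∀ t, 0 ≤ t → t < η →
      r * f 0 + (1 - r) * f (1 / (1 - r)) <
        P.real Bᶜ * f (t / P.real Bᶜ) + P.real B * f ((1 - t) / P.real B)) := by
    by_cases hb : 0 < P.real B
    · have hbc : 0 < P.real Bᶜ := by linarith
      have g1 : Tendsto (fun t : ℝ => f (t / P.real Bᶜ)) (𝓝[≥] 0) (𝓝 (f 0)) := by
        refine (hc 0 (by simp)).tendsto.comp (tendsto_nhdsWithin_iff.2 ⟨?_, ?_⟩)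
        · have : Tendsto (fun t : ℝ => t / P.real Bᶜ) (𝓝 0) (𝓝 (0 / P.real Bᶜ)) :=
            (continuous_id.div_const _).tendsto 0
          rw [zero_div] at this
          exact this.mono_left nhdsWithin_le_nhds
        · filter_upwards [self_mem_nhdsWithin] with t ht
          exact div_nonneg ht hbc.le
      have g2 : Tendsto (fun t : ℝ => f ((1 - t) / P.real B)) (𝓝[≥] 0)
          (𝓝 (f (1 / P.real B))) := by
        have h1 : ContinuousAt f (1 / P.real B) :=
          (hf_cvx.convexOn.continuousOn isOpen_Ioi).continuousAt
            (isOpen_Ioi.mem_nhds (by simp only [Set.mem_Ioi]; positivity))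
        refine h1.tendsto.comp ?_
        have : Tendsto (fun t : ℝ => (1 - t) / P.real B) (𝓝 0) (𝓝 ((1 - 0) / P.real B)) :=
          ((continuous_const.sub continuous_id).div_const _).tendsto 0
        rw [sub_zero] at this
        exact this.mono_left nhdsWithin_le_nhds
      have g3 := (g1.const_mul (P.real Bᶜ)).add (g2.const_mul (P.real B))
      have hlt := aux_mono f hf_cvx hf0 (P.real B) (1 - r) hb hBr
      rw [← hBc, sub_sub_cancel] at hlt
      have g4 := g3.eventually (lt_mem_nhds hlt)
      obtain ⟨u, hu, hsub⟩ := (mem_nhdsGE_iff_exists_Ico_subset).1 g4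
      refine ⟨min u 1, lt_min hu one_pos, min_le_right _ _, fun _ t ht0 ht => ?_⟩
      exact hsub ⟨ht0, ht.trans_le (min_le_left _ _)⟩
    · exact ⟨1, one_pos, le_rfl, fun h => absurd h hb⟩
  obtain ⟨η, hη0, hη1, hη⟩ := hη
  obtain ⟨Q, hQp, hQd, hQl⟩ := hQ (ENNReal.ofReal η * ε)
    (ENNReal.mul_pos (by simpa using hη0) hε0)
  have hQt : Q.real Bᶜ < η := by
    have h1 : Q Bᶜ ≤ (∫⁻ p, l p ∂Q) / ε := by
      have := meas_ge_le_lintegral_div (μ := Q) hl.aemeasurable hε0 hεt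
      convert this using 2
      ext p; simp [hBdef]
    have h2 : Q Bᶜ < ENNReal.ofReal η :=
      h1.trans_lt ((ENNReal.div_lt_iff (Or.inl hε0) (Or.inl hεt)).2 hQl)
    exact (ENNReal.lt_ofReal_iff_toReal_lt (measure_ne_top _ _)).1 h2
  have hQc : Q.real Bᶜ = 1 - Q.real B := probReal_compl_eq_one_sub hB
  unfold fDiv at hQd
  split_ifs at hQd with hcond
  swap
  · exact absurd hQd (not_le.2 (EReal.coe_lt_top _))
  obtain ⟨hQP, hint⟩ := hcond
  have hQd' := EReal.coe_le_coe_iff.1 hQd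
  have hb : 0 < P.real B := by
    rcases eq_or_lt_of_le (measureReal_nonneg (μ := P) (s := B)) with h | h
    · have h0 : P B = 0 := by
        rwa [eq_comm, measureReal_eq_zero_iff] at h
      have : Q.real B = 0 := by rw [measureReal_eq_zero_iff]; exact hQP h0
      linarith
    · exact h
  have j1 := aux_jensen f hc hv P Q hQP hint B hb
  have j2 := aux_jensen f hc hv P Q hQP hint Bᶜ (by linarith)
  have j3 := integral_add_compl hB hint
  have j4 := hη hb (Q.real Bᶜ) measureReal_nonneg hQt
  rw [show 1 - Q.real Bᶜ = Q.real B by linarith] at j4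
  linarith

lemma aux_fdiv {Ω : Type*} [MeasurableSpace Ω] (f : ℝ → ℝ)
    (P : Measure Ω) [IsProbabilityMeasure P] (r : ℝ) (hr1 : r < 1)
    (C : Set Ω) (hC : MeasurableSet C) (hPC : P C = ENNReal.ofReal (1 - r)) :
    ∃ Q : Measure Ω, IsProbabilityMeasure Q ∧
      fDiv f Q P ≤ ((r * f 0 + (1 - r) * f (1 / (1 - r)) : ℝ) : EReal) ∧ Q Cᶜ = 0 := by
  have h1r : 0 < 1 - r := by linarith
  set d : Ω → ℝ≥0∞ := C.indicator (fun _ => ENNReal.ofReal (1 / (1 - r))) with hd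
  have hdm : Measurable d := measurable_const.indicator hC
  have hPCr : P.real C = 1 - r := by
    rw [measureReal_def, hPC, ENNReal.toReal_ofReal h1r.le]
  have hPCc : P.real Cᶜ = r := by
    rw [probReal_compl_eq_one_sub hC, hPCr]; ring
  refine ⟨P.withDensity d, ⟨?_⟩, ?_, ?_⟩
  · rw [withDensity_apply _ MeasurableSet.univ, Measure.restrict_univ, hd,
      lintegral_indicator_const hC, hPC, ← ENNReal.ofReal_mul (by positivity)]
    rw [one_div, inv_mul_cancel₀ h1r.ne']; simp
  · have hae : (fun ω => f (((P.withDensity d).rnDeriv P) ω).toReal) =ᵐ[P]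
        fun ω => C.indicator (fun _ => f (1 / (1 - r))) ω + Cᶜ.indicator (fun _ => f 0) ω := by
      filter_upwards [Measure.rnDeriv_withDensity P hdm] with ω hω
      rw [hω, hd]
      by_cases h : ω ∈ C
      · rw [Set.indicator_of_mem h, Set.indicator_of_mem h,
          Set.indicator_of_notMem (by simpa using h), add_zero,
          ENNReal.toReal_ofReal (by positivity)]
      · simp [h]
    have i1 : Integrable (C.indicator (fun _ => f (1 / (1 - r)))) P :=
      (integrable_const _).indicator hC
    have i2 : Integrable (Cᶜ.indicator (fun _ => f 0)) P :=
      (integrable_const _).indicator hC.compl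
    unfold fDiv
    rw [if_pos ⟨withDensity_absolutelyContinuous _ _, (integrable_congr hae).2 (i1.add i2)⟩]
    rw [integral_congr_ae hae, integral_add i1 i2, integral_indicator_const _ hC,
      integral_indicator_const _ hC.compl, hPCr, hPCc, smul_eq_mul, smul_eq_mul, add_comm]
  · rw [withDensity_apply _ hC.compl, hd]
    rw [setLIntegral_congr_fun (g := fun _ => 0) hC.compl]
    · simp
    · intro x hx; simp [Set.indicator, show x ∉ C from hx]

lemma aux_PT {𝒳 𝒴 : Type*} [MeasurableSpace 𝒳] [Fintype 𝒴] [MeasurableSpace 𝒴]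
    [MeasurableSingletonClass 𝒴] (PX : Measure 𝒳) (PT : Measure (𝒳 × 𝒴))
    (W : 𝒳 → 𝒴 → ℝ≥0∞) (hW : ∀ y, Measurable fun x => W x y)
    (hPT : ∀ (A : Set 𝒳) (y : 𝒴), MeasurableSet A →
      PT (A ×ˢ ({y} : Set 𝒴)) = ∫⁻ x in A, W x y ∂PX)
    (S : Set (𝒳 × 𝒴)) (hS : MeasurableSet S) :
    PT S = ∫⁻ x, ∑ y, {x | (x, y) ∈ S}.indicator (fun x => W x y) x ∂PX := by
  have hSy : ∀ y, MeasurableSet {x | (x, y) ∈ S} := fun y => measurable_prodMk_right hS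
  have hU : S = ⋃ y, {x | (x, y) ∈ S} ×ˢ ({y} : Set 𝒴) := by
    ext ⟨x, y⟩; simp
  conv_lhs => rw [hU]
  rw [measure_iUnion, tsum_fintype, lintegral_finsetSum]
  · refine Finset.sum_congr rfl fun y _ => ?_
    rw [hPT _ _ (hSy y), lintegral_indicator (hSy y)]
  · exact fun y _ => (hW y).indicator (hSy y)
  · intro y z hyz
    rw [Function.onFun, Set.disjoint_left]
    rintro ⟨x, w⟩ h1 h2
    simp at h1 h2
    exact hyz (h1.2.symm.trans h2.2)
  · exact fun y => (hSy y).prod (measurableSet_singleton y)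

/-- Under the stated assumptions, with
`δ := r f(0) + (1-r) f(1/(1-r))`, every minimizer `θ̃` of
`θ ↦ inf_{Q : D_f(Q‖P_T) ≤ δ} E_Q[ℒ_θ]` satisfies `h_{θ̃} = h⋆` a.s. under `P_𝒳`. -/
theorem relaxed_problem_unique_solution
    {𝒳 : Type*} [MetricSpace 𝒳] [CompleteSpace 𝒳] [TopologicalSpace.SeparableSpace 𝒳]
    [MeasurableSpace 𝒳] [BorelSpace 𝒳]
    {𝒴 : Type*} [Fintype 𝒴] [TopologicalSpace 𝒴] [DiscreteTopology 𝒴]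
    [MeasurableSpace 𝒴] [MeasurableSingletonClass 𝒴]
    (PX : Measure 𝒳) [IsProbabilityMeasure PX]
    (hstar : 𝒳 → 𝒴) (hstar_meas : Measurable hstar)
    -- sample-dependent transition matrix
    (T : 𝒳 → 𝒴 → 𝒴 → ℝ)
    (hT_meas : ∀ y ytilde : 𝒴, Measurable fun x => T x y ytilde)
    (hT_nonneg : ∀ x y ytilde, 0 ≤ T x y ytilde)
    (hT_sum : ∀ x y, ∑ ytilde : 𝒴, T x y ytilde = 1)
    -- the noisy-label distribution P_T
    (PT : Measure (𝒳 × 𝒴)) [IsProbabilityMeasure PT]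
    (hPT : ∀ (A : Set 𝒳) (y : 𝒴), MeasurableSet A →
      PT (A ×ˢ ({y} : Set 𝒴)) = ∫⁻ x in A, ENNReal.ofReal (T x (hstar x) y) ∂PX)
    -- (1) noise level r
    (r : ℝ) (hr0 : 0 < r) (hr1 : r < 1)
    (hT_diag : ∀ x, T x (hstar x) (hstar x) = 1 - r)
    (hT_off : ∀ x y, y ≠ hstar x → T x (hstar x) y < 1 - r)
    -- (2) classifier family valued in probability vectors, containing the exact labels
    {Θ : Type*} (hθ : Θ → 𝒳 → 𝒴 → ℝ)
    (hθ_nonneg : ∀ θ x y, 0 ≤ hθ θ x y)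
    (hθ_sum : ∀ θ x, ∑ y : 𝒴, hθ θ x y = 1)
    (θs : Θ)
    (hθs : ∀ x, hθ θs x = fun y => if y = hstar x then (1 : ℝ) else 0)
    -- (3) the loss function, vanishing exactly on one-hot matches
    (L : (𝒴 → ℝ) → 𝒴 → ℝ≥0∞)
    (hL : ∀ (p : 𝒴 → ℝ) (y : 𝒴), L p y = 0 ↔ p = fun y' => if y' = y then (1 : ℝ) else 0)
    -- (4) lower semicontinuity of `ℒ_θ(x,y) = L(h_θ(x), y)` on `𝒳 × 𝒴`
    (hLSC : ∀ θ : Θ, LowerSemicontinuous fun p : 𝒳 × 𝒴 => L (hθ θ p.1) p.2)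
    -- (5) strictly convex f with f(1) = 0, finite continuous extension at 0,
    -- and everywhere-finite Legendre transform
    (f : ℝ → ℝ) (hf_cvx : StrictConvexOn ℝ (Set.Ioi (0 : ℝ)) f) (hf1 : f 1 = 0)
    (hf0 : ContinuousWithinAt f (Set.Ioi (0 : ℝ)) 0)
    (hfstar : ∀ y : ℝ, BddAbove ((fun x => y * x - f x) '' Set.Ioi (0 : ℝ)))
    -- θ̃ is a minimizer of the relaxed problem with δ = r f(0) + (1-r) f(1/(1-r))
    (θt : Θ)
    (hθt : ∀ θ : Θ,
      (⨅ Q : {Q : Measure (𝒳 × 𝒴) // IsProbabilityMeasure Q ∧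
          fDiv f Q PT ≤ ((r * f 0 + (1 - r) * f (1 / (1 - r)) : ℝ) : EReal)},
        ∫⁻ p, L (hθ θt p.1) p.2 ∂(Q : Measure (𝒳 × 𝒴))) ≤
      (⨅ Q : {Q : Measure (𝒳 × 𝒴) // IsProbabilityMeasure Q ∧
          fDiv f Q PT ≤ ((r * f 0 + (1 - r) * f (1 / (1 - r)) : ℝ) : EReal)},
        ∫⁻ p, L (hθ θ p.1) p.2 ∂(Q : Measure (𝒳 × 𝒴)))) :
    ∀ᵐ x ∂PX, hθ θt x = fun y => if y = hstar x then (1 : ℝ) else 0 := by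
  have h1r : 0 < 1 - r := by linarith
  have hTh : ∀ y, Measurable fun x => T x (hstar x) y := fun y => by
    have : Measurable (fun p : 𝒳 × 𝒴 => T p.1 p.2 y) :=
      measurable_from_prod_countable_left fun z => hT_meas z y
    exact this.comp (measurable_id.prodMk hstar_meas)
  have hW : ∀ y, Measurable fun x => ENNReal.ofReal (T x (hstar x) y) :=
    fun y => (hTh y).ennreal_ofReal
  have hform := aux_PT PX PT (fun x y => ENNReal.ofReal (T x (hstar x) y)) hW hPT
  have hlm : ∀ θ, Measurable fun p : 𝒳 × 𝒴 => L (hθ θ p.1) p.2 := fun θ =>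
    measurable_from_prod_countable_left fun y =>
      ((hLSC θ).comp (g := fun x => (x, y)) (by fun_prop)).measurable
  -- the clean set
  set C : Set (𝒳 × 𝒴) := {p | p.2 = hstar p.1} with hCdef
  have hC : MeasurableSet C :=
    measurableSet_eq_fun measurable_snd (hstar_meas.comp measurable_fst)
  have hPC : PT C = ENNReal.ofReal (1 - r) := by
    rw [hform C hC]
    have : ∀ x, ∑ y, {x | (x, y) ∈ C}.indicator
        (fun x => ENNReal.ofReal (T x (hstar x) y)) x = ENNReal.ofReal (1 - r) := by
      intro x
      rw [Finset.sum_eq_single (hstar x)]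
      · simp [hCdef, hT_diag]
      · intro y _ hy
        simp [hCdef, hy]
      · simp
    simp [this]
  obtain ⟨Qs, hQs, hQsd, hQs0⟩ := aux_fdiv f PT r hr1 C hC hPC
  have hzero : ∫⁻ p, L (hθ θs p.1) p.2 ∂Qs = 0 := by
    rw [lintegral_eq_zero_iff (hlm θs)]
    have : ∀ᵐ p ∂Qs, p ∈ C := by rw [ae_iff]; exact hQs0
    filter_upwards [this] with p hp
    have hp' : p.2 = hstar p.1 := hp
    simp only [Pi.zero_apply]
    rw [hL, hθs, hp']
  have hinf : (⨅ Q : {Q : Measure (𝒳 × 𝒴) // IsProbabilityMeasure Q ∧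
          fDiv f Q PT ≤ ((r * f 0 + (1 - r) * f (1 / (1 - r)) : ℝ) : EReal)},
        ∫⁻ p, L (hθ θt p.1) p.2 ∂(Q : Measure (𝒳 × 𝒴))) ≤ 0 :=
    (hθt θs).trans ((iInf_le _ ⟨Qs, hQs, hQsd⟩).trans hzero.le)
  have hkey := aux_key f hf_cvx hf0 PT r hr0 hr1 (fun p => L (hθ θt p.1) p.2) (hlm θt) (by
    intro κ hκ
    obtain ⟨⟨Q, h1, h2⟩, h3⟩ := iInf_lt_iff.1 (hinf.trans_lt hκ)
    exact ⟨Q, h1, h2, h3⟩)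
  have hA : MeasurableSet {p : 𝒳 × 𝒴 | L (hθ θt p.1) p.2 = 0} :=
    (hlm θt) (measurableSet_singleton 0)
  rw [hform _ hA] at hkey
  set φ : 𝒳 → ℝ≥0∞ := fun x => ∑ y, {x | (x, y) ∈ {p : 𝒳 × 𝒴 | L (hθ θt p.1) p.2 = 0}}.indicator
        (fun x => ENNReal.ofReal (T x (hstar x) y)) x with hφ
  have hφ1 : ∀ x y, hθ θt x = (fun y' => if y' = y then (1 : ℝ) else 0) →
      φ x = ENNReal.ofReal (T x (hstar x) y) := by
    intro x y hxy
    simp only [hφ]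
    rw [Finset.sum_eq_single y]
    · rw [Set.indicator_of_mem]
      simp only [Set.mem_setOf_eq]
      rw [hL]; exact hxy
    · intro z _ hz
      rw [Set.indicator_of_notMem]
      simp only [Set.mem_setOf_eq]
      rw [hL, hxy]
      intro h
      have := congrFun h z
      simp [hz] at this
    · simp
  have hφ2 : ∀ x, (∀ y, hθ θt x ≠ (fun y' => if y' = y then (1 : ℝ) else 0)) → φ x = 0 := by
    intro x hx
    simp only [hφ]
    refine Finset.sum_eq_zero fun y _ => ?_
    rw [Set.indicator_of_notMem]
    simp only [Set.mem_setOf_eq]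
    rw [hL]; exact hx y
  have hle : ∀ x, φ x ≤ ENNReal.ofReal (1 - r) := by
    intro x
    by_cases h : ∃ y, hθ θt x = (fun y' => if y' = y then (1 : ℝ) else 0)
    · obtain ⟨y, hy⟩ := h
      rw [hφ1 x y hy]
      apply ENNReal.ofReal_le_ofReal
      by_cases hyy : y = hstar x
      · rw [hyy, hT_diag]
      · exact (hT_off x y hyy).le
    · push Not at h
      rw [hφ2 x h]; exact zero_le
  have hcint : ∫⁻ _, ENNReal.ofReal (1 - r) ∂PX = ENNReal.ofReal (1 - r) := by simp
  have hae := ae_eq_of_ae_le_of_lintegral_le (μ := PX) (f := φ)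
    (g := fun _ => ENNReal.ofReal (1 - r)) (Filter.Eventually.of_forall hle)
    (ne_top_of_le_ne_top (by rw [hcint]; exact ENNReal.ofReal_ne_top) (lintegral_mono hle))
    aemeasurable_const (by rw [hcint]; exact hkey)
  filter_upwards [hae] with x hx
  by_cases h : ∃ y, hθ θt x = (fun y' => if y' = y then (1 : ℝ) else 0)
  · obtain ⟨y, hy⟩ := h
    by_cases hyy : y = hstar x
    · rw [hy, hyy]
    · exfalso
      rw [hφ1 x y hy] at hx
      have := hT_off x y hyy
      exact absurd hx ((ENNReal.ofReal_lt_ofReal_iff h1r).2 this).ne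
  · exfalso
    push Not at h
    rw [hφ2 x h] at hx
    exact (ENNReal.ofReal_pos.2 h1r).ne hx
end

section
/- Let 0 ≤ a < 1 < b ≤ ∞, let f : (a,b) → ℝ be convex with f(1) = 0, and let ℒ : 𝒵 → ℝ be measurable. Let P_n be the empirical distribution of points z_1, …, z_n ∈ 𝒵. Then for all δ > 0 and κ ≥ 0: inf_{Q : D_f(Q‖P_n) ≤ δ} { E_Q[ℒ] + κ D_f(Q‖P_n) } = sup_{λ > 0, ρ ∈ ℝ} { −λδ − ρ − (λ + κ) E_{P_n}[ f*( −(ℒ + ρ)/(λ + κ) ) ] }, where f* is the Legendre transform of f (with f extended continuously to the endpoints of its domain). -/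
open MeasureTheory Classical
open scoped ENNReal BigOperators

/-- The empirical distribution `P_n = (1/n) ∑ᵢ δ_{zᵢ}` of points `z₁, …, zₙ`. -/
noncomputable def empDist {𝒵 : Type*} [MeasurableSpace 𝒵] (n : ℕ) (z : Fin n → 𝒵) :
    Measure 𝒵 :=
  ((n : ℝ≥0∞))⁻¹ • ∑ i : Fin n, Measure.dirac (z i)

/-- The `f`-divergence for `f` defined on the interval `(a, b)` (with `b` possibly `∞`):
`D_f(Q ‖ P) = E_P[f(dQ/dP)]` when `Q ≪ P`, `dQ/dP` takes values in `[a, b]` a.e. (where `f`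
is understood as continuously extended to the endpoints) and the integrand is integrable;
`∞` otherwise. -/
noncomputable def fDivOn {Ω : Type*} [MeasurableSpace Ω] (a : ℝ) (b : EReal) (f : ℝ → ℝ)
    (Q P : Measure Ω) : EReal :=
  if Q ≪ P ∧ (∀ᵐ ω ∂P, a ≤ ((Q.rnDeriv P) ω).toReal ∧ (((Q.rnDeriv P) ω).toReal : EReal) ≤ b)
      ∧ Integrable (fun ω => f ((Q.rnDeriv P) ω).toReal) P
  then ((∫ ω, f ((Q.rnDeriv P) ω).toReal ∂P : ℝ) : EReal)
  else ⊤

/-- The Legendre transform `f*(y) = sup_{x ∈ (a,b)} {yx − f(x)}` of `f : (a,b) → ℝ`. -/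
noncomputable def fStarOn (a : ℝ) (b : EReal) (f : ℝ → ℝ) (y : ℝ) : EReal :=
  ⨆ x : {x : ℝ // a < x ∧ (x : EReal) < b}, ((y * (x : ℝ) - f x : ℝ) : EReal)

lemma strong_aux (n : ℕ) (I : Set ℝ) (hIo : IsOpen I) (h1 : (1:ℝ) ∈ I)
    (f : ℝ → ℝ) (hf : ConvexOn ℝ I f) (hf1 : f 1 = 0) (l : Fin n → ℝ) (hn : 0 < n)
    (δ κ V : ℝ) (hδ : 0 < δ) (hκ : 0 ≤ κ)
    (hV : ∀ x : Fin n → ℝ, (∀ i, x i ∈ I) → (n:ℝ)⁻¹ * ∑ i, x i = 1 →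
      (n:ℝ)⁻¹ * ∑ i, f (x i) ≤ δ → V ≤ (n:ℝ)⁻¹ * ∑ i, (l i * x i + κ * f (x i))) :
    ∃ lam rho : ℝ, 0 ≤ lam ∧ ∀ x : Fin n → ℝ, (∀ i, x i ∈ I) →
      V ≤ (n:ℝ)⁻¹ * ∑ i, (l i * x i + κ * f (x i)) + lam * ((n:ℝ)⁻¹ * ∑ i, f (x i) - δ)
        + rho * ((n:ℝ)⁻¹ * ∑ i, x i - 1) := by
  have hn0 : (n:ℝ) ≠ 0 := by positivity
  have hninv : (0:ℝ) ≤ (n:ℝ)⁻¹ := by positivity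
  set F : (Fin n → ℝ) → ℝ := fun x => (n:ℝ)⁻¹ * ∑ i, f (x i) with hF
  set M : (Fin n → ℝ) → ℝ := fun x => (n:ℝ)⁻¹ * ∑ i, x i with hM
  set G : (Fin n → ℝ) → ℝ := fun x => (n:ℝ)⁻¹ * ∑ i, (l i * x i + κ * f (x i)) with hG
  let C : Set (ℝ × ℝ × ℝ) := {p | ∃ x : Fin n → ℝ, (∀ i, x i ∈ I) ∧ F x - δ < p.1 ∧
    M x - 1 = p.2.1 ∧ G x < p.2.2}
  have hfc : ∀ x ∈ I, ContinuousAt f x := fun x hx =>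
    (hf.continuousOn hIo).continuousAt (hIo.mem_nhds hx)
  have hCconv : Convex ℝ C := by
    rintro ⟨u, v, w⟩ ⟨x, hx, h1, h2, h3⟩ ⟨u', v', w'⟩ ⟨x', hx', h1', h2', h3'⟩ s t hs ht hst
    simp only at h1 h2 h3 h1' h2' h3'
    have key : ∀ i, f (s * x i + t * x' i) ≤ s * f (x i) + t * f (x' i) := fun i => by
      simpa using hf.2 (hx i) (hx' i) hs ht hst
    refine ⟨fun i => s * x i + t * x' i, fun i => by simpa using hf.1 (hx i) (hx' i) hs ht hst, ?_, ?_, ?_⟩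
    · have : F (fun i => s * x i + t * x' i) ≤ s * F x + t * F x' := by
        simp only [hF]
        calc _ ≤ (n:ℝ)⁻¹ * ∑ i, (s * f (x i) + t * f (x' i)) := by gcongr with i; exact key i
          _ = _ := by rw [Finset.sum_add_distrib, ← Finset.mul_sum, ← Finset.mul_sum]; ring
      simp only [Prod.smul_mk, Prod.mk_add_mk, smul_eq_mul]
      have : s * u + t * u' > s * (F x - δ) + t * (F x' - δ) := by
        rcases hs.eq_or_lt with h | h
        · subst h; have : t = 1 := by linarith
          subst this; linarith
        · nlinarith
      have : δ = s * δ + t * δ := by rw [← add_mul, hst, one_mul]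
      linarith
    · simp only [Prod.smul_mk, Prod.mk_add_mk, smul_eq_mul, ← h2, ← h2', hM]
      rw [Finset.sum_add_distrib, ← Finset.mul_sum, ← Finset.mul_sum]
      linear_combination hst
    · have : G (fun i => s * x i + t * x' i) ≤ s * G x + t * G x' := by
        simp only [hG]
        calc _ ≤ (n:ℝ)⁻¹ * ∑ i, (s * (l i * x i + κ * f (x i)) + t * (l i * x' i + κ * f (x' i))) := by
              refine mul_le_mul_of_nonneg_left (Finset.sum_le_sum fun i _ => ?_) hninv
              have := mul_le_mul_of_nonneg_left (key i) hκ
              linarith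
          _ = _ := by rw [Finset.sum_add_distrib, ← Finset.mul_sum, ← Finset.mul_sum]; ring
      simp only [Prod.smul_mk, Prod.mk_add_mk, smul_eq_mul]
      have : s * w + t * w' > s * (G x) + t * (G x') := by
        rcases hs.eq_or_lt with h | h
        · subst h; have : t = 1 := by linarith
          subst this; linarith
        · nlinarith
      linarith
  have hCopen : IsOpen C := by
    rw [isOpen_iff_mem_nhds]
    rintro ⟨u, v, w⟩ ⟨x, hx, h1, h2, h3⟩
    simp only at h1 h2 h3
    let y : ℝ × ℝ × ℝ → Fin n → ℝ := fun p i => x i + (p.2.1 - v)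
    have hy0 : ∀ i, y (u, v, w) i = x i := fun i => by simp [y]
    have hyc : ∀ i, ContinuousAt (fun p => y p i) (u, v, w) := fun i => by
      simp only [y]; fun_prop
    have hfy : ∀ i, ContinuousAt (fun p => f (y p i)) (u, v, w) := fun i =>
      ContinuousAt.comp (f := fun p => y p i) (g := f) (by rw [hy0]; exact hfc _ (hx i)) (hyc i)
    have e1 : ∀ᶠ p in nhds (u, v, w), ∀ i, y p i ∈ I := by
      rw [Filter.eventually_all]
      intro i
      exact (hyc i).eventually (by simp only [hy0]; exact hIo.mem_nhds (hx i))
    have hy0' : y (u, v, w) = x := funext hy0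
    have cF : ContinuousAt (fun p => F (y p)) (u, v, w) := by
      simp only [hF]
      refine continuousAt_const.mul (tendsto_finsetSum _ fun i _ => hfy i)
    have cG : ContinuousAt (fun p => G (y p)) (u, v, w) := by
      simp only [hG]
      refine continuousAt_const.mul (tendsto_finsetSum _ fun i _ => ?_)
      exact ((continuousAt_const.mul (hyc i)).add (continuousAt_const.mul (hfy i)))
    have e2 : ∀ᶠ p in nhds (u, v, w), F (y p) - δ < p.1 :=
      (cF.sub continuousAt_const).eventually_lt continuousAt_fst (by simpa [hy0'] using h1)
    have e3 : ∀ᶠ p in nhds (u, v, w), G (y p) < p.2.2 :=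
      cG.eventually_lt (by fun_prop) (by simpa [hy0'] using h3)
    filter_upwards [e1, e2, e3] with p hp1 hp2 hp3
    refine ⟨y p, hp1, hp2, ?_, hp3⟩
    simp only [hM, y, Finset.sum_add_distrib] at h2 ⊢
    simp only [Finset.sum_const, Finset.card_univ, Fintype.card_fin, nsmul_eq_mul]
    rw [mul_add, inv_mul_cancel_left₀ hn0]
    linarith
  have hVC : ((0:ℝ), (0:ℝ), V) ∉ C := by
    rintro ⟨x, hx, h1, h2, h3⟩
    simp only at h1 h2 h3
    have := hV x hx (by simp only [hM] at h2; linarith) (by simp only [hF] at h1; linarith)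
    simp only [hG] at h3
    linarith
  obtain ⟨φ, hφ⟩ := geometric_hahn_banach_open_point hCconv hCopen hVC
  set α := φ (1, 0, 0)
  set β := φ (0, 1, 0)
  set γ := φ (0, 0, 1)
  have hφe : ∀ u v w : ℝ, φ (u, v, w) = α * u + β * v + γ * w := by
    intro u v w
    have : ((u, v, w) : ℝ × ℝ × ℝ) = u • ((1:ℝ), (0:ℝ), (0:ℝ)) + v • ((0:ℝ), (1:ℝ), (0:ℝ)) + w • ((0:ℝ), (0:ℝ), (1:ℝ)) := by simp
    rw [this]; simp only [map_add, map_smul, smul_eq_mul]; ring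
  have hone : ∀ u w : ℝ, 0 ≤ u → G (fun _ => 1) < w → α * u + γ * w < γ * V := by
    intro u w hu hw
    have := hφ (u, 0, w) ⟨fun _ => 1, fun _ => h1, by simp [hF, hf1]; linarith, by simp [hM, hn0], hw⟩
    rw [hφe, hφe] at this
    linarith
  have hγ : γ < 0 := by
    set w := max (G fun _ => 1) V + 1
    have h1 : G (fun _ => 1) < w := by have := le_max_left (G fun _ => 1) V; simp only [w]; linarith
    have h2 : V < w := by have := le_max_right (G fun _ => 1) V; simp only [w]; linarith
    have := hone 0 w le_rfl h1
    by_contra hc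
    push Not at hc
    nlinarith
  have hα : α ≤ 0 := by
    by_contra hc
    push Not at hc
    set w := G (fun _ => 1) + 1
    have := hone (|γ * V - γ * w| / α) w (by positivity) (by simp [w])
    rw [mul_div_cancel₀ _ hc.ne'] at this
    linarith [le_abs_self (γ * V - γ * w)]
  refine ⟨α / γ, β / γ, div_nonneg_of_nonpos hα hγ.le, fun x hx => ?_⟩
  change V ≤ G x + α / γ * (F x - δ) + β / γ * (M x - 1)
  have hle : α * (F x - δ) + β * (M x - 1) + γ * G x ≤ γ * V := by
    have hlim : Filter.Tendsto (fun s : ℝ => α * (F x - δ + s) + β * (M x - 1) + γ * (G x + s)) (nhdsWithin 0 (Set.Ioi 0)) (nhds (α * (F x - δ + 0) + β * (M x - 1) + γ * (G x + 0))) := by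
      apply Filter.Tendsto.mono_left _ nhdsWithin_le_nhds
      exact Continuous.tendsto (f := fun s : ℝ => α * (F x - δ + s) + β * (M x - 1) + γ * (G x + s)) (by fun_prop) 0
    have := le_of_tendsto hlim (b := γ * V) ?_
    · simpa using this
    filter_upwards [self_mem_nhdsWithin] with s hs
    have := hφ (F x - δ + s, M x - 1, G x + s) ⟨x, hx, by simpa using hs, rfl, by simpa using hs⟩
    rw [hφe, hφe] at this
    linarith
  have : G x + α / γ * (F x - δ) + β / γ * (M x - 1) = (α * (F x - δ) + β * (M x - 1) + γ * G x) / γ := by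
    field_simp [hγ.ne]; ring
  rw [this, le_div_iff_of_neg hγ]
  linarith

lemma subgrad_aux (I : Set ℝ) (hIo : IsOpen I) (f : ℝ → ℝ) (hf : ConvexOn ℝ I f) :
    ∃ g : ℝ → ℝ, ∀ x ∈ I, ∀ y ∈ I, f x + g x * (y - x) ≤ f y := by
  refine ⟨fun x => derivWithin f (Set.Ioi x) x, fun x hx y hy => ?_⟩
  have hxi : x ∈ interior I := by rwa [hIo.interior_eq]
  rcases lt_trichotomy x y with h | h | h
  · have := hf.rightDeriv_le_slope_of_mem_interior hxi hy h
    rw [slope_def_field, le_div_iff₀ (by linarith)] at this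
    linarith
  · subst h; simp
  · have h1 := hf.slope_le_leftDeriv_of_mem_interior hy hxi h
    have h2 := hf.leftDeriv_le_rightDeriv_of_mem_interior hxi
    have := h1.trans h2
    rw [slope_def_field, div_le_iff₀ (by linarith)] at this
    linarith

lemma ereal_coe_sum {ι : Type*} (s : Finset ι) (g : ι → ℝ) :
    ((∑ i ∈ s, g i : ℝ) : EReal) = ∑ i ∈ s, (g i : EReal) := by
  induction s using Finset.induction_on with
  | empty => simp
  | insert a s ha ih => rw [Finset.sum_insert ha, Finset.sum_insert ha, EReal.coe_add, ih]

lemma strong_aux2 (n : ℕ) (I : Set ℝ) (hIo : IsOpen I) (h1 : (1:ℝ) ∈ I)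
    (f : ℝ → ℝ) (hf : ConvexOn ℝ I f) (hf1 : f 1 = 0) (l : Fin n → ℝ) (hn : 0 < n)
    (δ κ V : ℝ) (hδ : 0 < δ) (hκ : 0 ≤ κ)
    (hV : ∀ x : Fin n → ℝ, (∀ i, x i ∈ I) → (n:ℝ)⁻¹ * ∑ i, x i = 1 →
      (n:ℝ)⁻¹ * ∑ i, f (x i) ≤ δ → V ≤ (n:ℝ)⁻¹ * ∑ i, (l i * x i + κ * f (x i)))
    (ε : ℝ) (hε : 0 < ε) :
    ∃ lam rho : ℝ, 0 < lam ∧ ∀ x : Fin n → ℝ, (∀ i, x i ∈ I) →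
      (lam + κ) * ((n:ℝ)⁻¹ * ∑ i, (-(l i + rho) / (lam + κ) * x i - f (x i)))
        ≤ -(lam * δ) - rho - V + ε := by
  obtain ⟨lam, rho, hl, H⟩ := strong_aux n I hIo h1 f hf hf1 l hn δ κ V hδ hκ hV
  obtain ⟨g, hg⟩ := subgrad_aux I hIo f hf
  set e := ε / δ
  have he : 0 < e := by positivity
  have heδ : e * δ = ε := by simp only [e]; field_simp
  refine ⟨lam + e, rho - e * g 1, by linarith, fun x hx => ?_⟩
  have hx' := H x hx
  have hninv : (0:ℝ) ≤ (n:ℝ)⁻¹ := by positivity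
  have hn0 : (n:ℝ) ≠ 0 := by positivity
  have h2 : g 1 * ((n:ℝ)⁻¹ * ∑ i, x i - 1) ≤ (n:ℝ)⁻¹ * ∑ i, f (x i) := by
    have : ∑ i, (g 1 * (x i - 1)) ≤ ∑ i, f (x i) := by
      refine Finset.sum_le_sum fun i _ => ?_
      have := hg 1 h1 (x i) (hx i)
      linarith
    have := mul_le_mul_of_nonneg_left this hninv
    rw [← Finset.mul_sum, Finset.sum_sub_distrib] at this
    simp only [Finset.sum_const, Finset.card_univ, Fintype.card_fin, nsmul_eq_mul, mul_one] at this
    have e2 : (n:ℝ)⁻¹ * (g 1 * (∑ i, x i - n)) = g 1 * ((n:ℝ)⁻¹ * ∑ i, x i - 1) := by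
      field_simp
    linarith
  have hpos : lam + e + κ ≠ 0 := by positivity
  have h3 : (lam + e + κ) * ((n:ℝ)⁻¹ * ∑ i, (-(l i + (rho - e * g 1)) / (lam + e + κ) * x i - f (x i)))
      = -((n:ℝ)⁻¹ * ∑ i, (l i * x i + κ * f (x i))) - (rho - e * g 1) * ((n:ℝ)⁻¹ * ∑ i, x i)
        - (lam + e) * ((n:ℝ)⁻¹ * ∑ i, f (x i)) := by
    simp only [Finset.mul_sum, ← Finset.sum_neg_distrib, ← Finset.sum_sub_distrib]
    refine Finset.sum_congr rfl fun i _ => ?_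
    field_simp
    ring
  rw [h3]
  have := mul_le_mul_of_nonneg_left h2 he.le
  nlinarith

lemma sum_sup_aux (n : ℕ) (I : Set ℝ) (h1 : (1:ℝ) ∈ I) (g : Fin n → ℝ → ℝ) (B : ℝ)
    (H : ∀ x : Fin n → ℝ, (∀ i, x i ∈ I) → ∑ i, g i (x i) ≤ B) :
    ∃ S : Fin n → ℝ, (∀ i, ∀ x ∈ I, g i x ≤ S i) ∧ ∑ i, S i ≤ B := by
  have hb : ∀ i, BddAbove (g i '' I) := by
    intro i
    refine ⟨B - ∑ j ∈ Finset.univ.erase i, g j 1, ?_⟩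
    rintro _ ⟨x, hx, rfl⟩
    have := H (Function.update (fun _ => 1) i x) (fun j => by
      by_cases h : j = i
      · subst h; simpa using hx
      · simpa [h] using h1)
    rw [← Finset.add_sum_erase _ _ (Finset.mem_univ i)] at this
    simp only [Function.update_self] at this
    have h2 : ∑ j ∈ Finset.univ.erase i, g j (Function.update (fun _ => (1:ℝ)) i x j)
        = ∑ j ∈ Finset.univ.erase i, g j 1 := by
      refine Finset.sum_congr rfl fun j hj => ?_
      rw [Function.update_of_ne (Finset.ne_of_mem_erase hj)]
    linarith
  refine ⟨fun i => sSup (g i '' I), fun i x hx => le_csSup (hb i) ⟨x, hx, rfl⟩, ?_⟩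
  refine le_of_forall_pos_le_add fun ε hε => ?_
  have hch : ∀ i, ∃ x ∈ I, sSup (g i '' I) - ε / (n + 1) < g i x := by
    intro i
    have hp : 0 < ε / ((n:ℝ) + 1) := by positivity
    obtain ⟨_, ⟨x, hx, rfl⟩, h⟩ := exists_lt_of_lt_csSup (s := g i '' I) ⟨_, 1, h1, rfl⟩
      (sub_lt_self (sSup (g i '' I)) hp)
    exact ⟨x, hx, h⟩
  choose x hx hlt using hch
  have h2 := H x hx
  have h3 : ∑ i, sSup (g i '' I) ≤ ∑ i, (g i (x i) + ε / (n + 1)) :=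
    Finset.sum_le_sum fun i _ => by linarith [hlt i]
  rw [Finset.sum_add_distrib] at h3
  simp only [Finset.sum_const, Finset.card_univ, Fintype.card_fin, nsmul_eq_mul] at h3
  have h4 : (n:ℝ) * (ε / (n + 1)) ≤ ε := by
    rw [← mul_div_assoc, div_le_iff₀ (by positivity)]
    nlinarith
  linarith

lemma emp_null {𝒵 : Type*} [MeasurableSpace 𝒵] {n : ℕ} {z : Fin n → 𝒵} {s : Set 𝒵}
    (h : empDist n z s = 0) (i : Fin n) : Measure.dirac (z i) s = 0 := by
  simp only [empDist, Measure.smul_apply, smul_eq_mul, mul_eq_zero, Measure.coe_finsetSum,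
    Finset.sum_apply, ENNReal.inv_eq_zero, ENNReal.natCast_ne_top, false_or,
    Finset.sum_eq_zero_iff, Finset.mem_univ, true_imp_iff] at h
  exact h i

lemma emp_ae {𝒵 : Type*} [MeasurableSpace 𝒵] {n : ℕ} {z : Fin n → 𝒵} {p : 𝒵 → Prop}
    (h : ∀ᵐ ω ∂(empDist n z), p ω) (i : Fin n) : p (z i) := by
  have h1 := emp_null (ae_iff.1 h) i
  by_contra hc
  have h2 := Measure.le_dirac_apply (s := {a | ¬ p a}) (a := z i)
  rw [h1, Set.indicator_of_mem (by exact hc)] at h2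
  simp at h2

lemma emp_ae_of {𝒵 : Type*} [MeasurableSpace 𝒵] {n : ℕ} {z : Fin n → 𝒵} {s : Set 𝒵}
    (hs : MeasurableSet s) (h : ∀ i, z i ∈ s) : ∀ᵐ ω ∂(empDist n z), ω ∈ s := by
  rw [ae_iff]
  change empDist n z sᶜ = 0
  simp [empDist, Measure.smul_apply, Measure.dirac_apply' _ hs.compl, h]

instance emp_fin {𝒵 : Type*} [MeasurableSpace 𝒵] {n : ℕ} {z : Fin n → 𝒵} [NeZero n] :
    IsFiniteMeasure (empDist n z) := by
  refine ⟨?_⟩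
  have hn : (n : ℝ≥0∞) ≠ 0 := by exact_mod_cast NeZero.ne n
  simp [empDist, Measure.smul_apply]
  rw [ENNReal.inv_mul_cancel hn (by simp)]; simp

lemma emp_integrable {𝒵 : Type*} [MeasurableSpace 𝒵] {n : ℕ} {z : Fin n → 𝒵} [NeZero n]
    {h : 𝒵 → ℝ} (hh : AEStronglyMeasurable h (empDist n z)) : Integrable h (empDist n z) := by
  refine Integrable.congr ?_ hh.ae_eq_mk.symm
  have hn : (n : ℝ≥0∞) ≠ 0 := by exact_mod_cast NeZero.ne n
  refine Integrable.smul_measure ?_ (by simpa using NeZero.ne n)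
  rw [integrable_finsetSum_measure]
  exact fun i _ => integrable_dirac' hh.stronglyMeasurable_mk (by simp)

lemma emp_integral {𝒵 : Type*} [MeasurableSpace 𝒵] {n : ℕ} {z : Fin n → 𝒵}
    {h : 𝒵 → ℝ} (hh : AEStronglyMeasurable h (empDist n z)) :
    ∫ ω, h ω ∂(empDist n z) = (n:ℝ)⁻¹ * ∑ i, h (z i) := by
  obtain ⟨g, hg, hge⟩ := hh
  rw [integral_congr_ae hge]
  have h2 : ∀ i, h (z i) = g (z i) := emp_ae hge
  simp only [h2]
  rw [empDist, integral_smul_measure, integral_finsetSum_measure]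
  · simp only [integral_dirac' _ _ hg]
    simp
  · exact fun i _ => integrable_dirac' hg (by simp)

lemma exists_meas (S : Finset ℝ) (g : ℝ → ℝ) : ∃ g' : ℝ → ℝ, Measurable g' ∧ ∀ t ∈ S, g' t = g t := by
  refine ⟨fun t => ∑ c ∈ S, Set.indicator {c} (fun _ => g c) t, ?_, ?_⟩
  · exact Finset.measurable_sum _ fun c _ => measurable_const.indicator (measurableSet_singleton c)
  · intro t ht
    simp [Set.indicator_apply, ht]

lemma fStar_ge (a : ℝ) (b : EReal) (ha1 : (a : EReal) < 1) (hb1 : (1 : EReal) < b) (f : ℝ → ℝ)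
    (hfa : ContinuousWithinAt f (Set.Ioi a) a)
    (hfb : ∀ c : ℝ, b = (c : EReal) → ContinuousWithinAt f (Set.Iio c) c)
    (y x : ℝ) (hx : a ≤ x) (hxb : (x : EReal) ≤ b) :
    ((y * x - f x : ℝ) : EReal) ≤ fStarOn a b f y := by
  have ha1' : a < 1 := by exact_mod_cast ha1
  have hin : ∀ t : ℝ, a < t → (t : EReal) < b → ((y * t - f t : ℝ) : EReal) ≤ fStarOn a b f y :=
    fun t h1 h2 => le_iSup (fun x : {x : ℝ // a < x ∧ (x : EReal) < b} =>
      ((y * (x : ℝ) - f x : ℝ) : EReal)) ⟨t, h1, h2⟩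
  rcases hx.eq_or_lt with h | h
  · subst h
    have ht : Filter.Tendsto (fun t => ((y * t - f t : ℝ) : EReal)) (nhdsWithin a (Set.Ioi a))
        (nhds ((y * a - f a : ℝ) : EReal)) := by
      refine (continuous_coe_real_ereal.tendsto _).comp ?_
      exact ((continuousWithinAt_const.mul continuousWithinAt_id).sub hfa)
    refine le_of_tendsto ht ?_
    filter_upwards [Ioo_mem_nhdsGT ha1'] with t ht
    exact hin t ht.1 (lt_trans (by exact_mod_cast ht.2) hb1)
  · rcases hxb.eq_or_lt with h' | h'
    · have hfx := hfb x h'.symm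
      have hx1 : 1 < x := by rw [← h'] at hb1; exact_mod_cast hb1
      have ht : Filter.Tendsto (fun t => ((y * t - f t : ℝ) : EReal)) (nhdsWithin x (Set.Iio x))
          (nhds ((y * x - f x : ℝ) : EReal)) := by
        refine (continuous_coe_real_ereal.tendsto _).comp ?_
        exact ((continuousWithinAt_const.mul continuousWithinAt_id).sub hfx)
      refine le_of_tendsto ht ?_
      filter_upwards [Ioo_mem_nhdsLT hx1] with t ht
      exact hin t (ha1'.trans ht.1) (by rw [← h']; exact_mod_cast ht.2)
    · exact hin x h h'

/-- Construction of a feasible measure from weights. -/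
lemma exists_Q {𝒵 : Type*} [MeasurableSpace 𝒵] (n : ℕ) (hn : 0 < n) (z : Fin n → 𝒵)
    (a : ℝ) (b : EReal) (ha0 : 0 ≤ a)
    (f : ℝ → ℝ) (hIo : IsOpen {x : ℝ | a < x ∧ (x : EReal) < b})
    (hf_cvx : ConvexOn ℝ {x : ℝ | a < x ∧ (x : EReal) < b} f)
    (L : 𝒵 → ℝ) (hL : Measurable L) (x : Fin n → ℝ)
    (hx : ∀ i, x i ∈ {x : ℝ | a < x ∧ (x : EReal) < b}) (hx1 : (n:ℝ)⁻¹ * ∑ i, x i = 1) :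
    ∃ Q : Measure 𝒵, IsProbabilityMeasure Q ∧ ∃ d : ℝ, fDivOn a b f Q (empDist n z) = (d : EReal)
      ∧ d ≤ (n:ℝ)⁻¹ * ∑ i, f (x i) ∧ ∫ ζ, L ζ ∂Q = (n:ℝ)⁻¹ * ∑ i, L (z i) * x i := by
  have : NeZero n := ⟨hn.ne'⟩
  have hn0 : (0:ℝ) < (n:ℝ)⁻¹ := by positivity
  have hx0 : ∀ i, 0 ≤ (n:ℝ)⁻¹ * x i := fun i => mul_nonneg hn0.le (ha0.trans (hx i).1.le)
  set P := empDist n z with hP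
  let Q : Measure 𝒵 := ∑ i, ENNReal.ofReal ((n:ℝ)⁻¹ * x i) • Measure.dirac (z i)
  have hQp : IsProbabilityMeasure Q := by
    refine ⟨?_⟩
    simp only [Q, Measure.coe_finsetSum, Finset.sum_apply, Measure.smul_apply, smul_eq_mul,
      measure_univ, mul_one]
    rw [← ENNReal.ofReal_sum_of_nonneg fun i _ => hx0 i, ← Finset.mul_sum, hx1, ENNReal.ofReal_one]
  have hQP : Q ≪ P := by
    intro s hs
    have := emp_null hs
    simp [Q, this]
  have hQint : ∀ h : 𝒵 → ℝ, StronglyMeasurable h → ∫ ω, h ω ∂Q = (n:ℝ)⁻¹ * ∑ i, h (z i) * x i := by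
    intro h hh
    simp only [Q]
    rw [integral_finsetSum_measure]
    · simp only [integral_smul_measure, integral_dirac' _ _ hh, ENNReal.toReal_ofReal (hx0 _), Finset.mul_sum, smul_eq_mul]
      exact Finset.sum_congr rfl fun i _ => by ring
    · exact fun i _ => (integrable_dirac' hh (by simp)).smul_measure ENNReal.ofReal_ne_top
  set r : 𝒵 → ℝ := fun ω => (Q.rnDeriv P ω).toReal with hr
  have hrm : Measurable r := (Measure.measurable_rnDeriv Q P).ennreal_toReal
  let S : Finset ℝ := Finset.univ.image fun i => r (z i)
  have hrS : ∀ i, r (z i) ∈ S := fun i => Finset.mem_image_of_mem _ (Finset.mem_univ i)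
  have haeS : ∀ᵐ ω ∂P, r ω ∈ S := emp_ae_of (s := r ⁻¹' S) (hrm S.measurableSet) hrS
  -- the key identity
  have key : ∀ g : ℝ → ℝ, ∑ i, g (r (z i)) * (x i - r (z i)) = 0 := by
    intro g
    obtain ⟨g', hg', hgS⟩ := exists_meas S g
    have e1 := hQint (fun ω => g' (r ω)) (hg'.comp hrm).stronglyMeasurable
    have e2 := integral_rnDeriv_smul (f := fun ω => g' (r ω)) hQP
    rw [emp_integral (by exact (hrm.mul (hg'.comp hrm)).aestronglyMeasurable), e1] at e2
    have e3 := mul_left_cancel₀ hn0.ne' e2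
    simp only [hgS _ (hrS _), smul_eq_mul] at e3
    simp only [mul_sub, Finset.sum_sub_distrib]
    rw [← e3, sub_eq_zero]
    exact Finset.sum_congr rfl fun i _ => by simp only [hr]; ring
  have hra : ∀ i, a < r (z i) := by
    intro i
    by_contra hc
    have := key (fun t => if t ≤ a then 1 else 0)
    have hpos : 0 < ∑ i, (fun t => if t ≤ a then (1:ℝ) else 0) (r (z i)) * (x i - r (z i)) := by
      refine Finset.sum_pos' (fun j _ => ?_) ⟨i, Finset.mem_univ i, ?_⟩
      · dsimp only
        split_ifs with h
        · linarith [(hx j).1]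
        · simp
      · dsimp only
        rw [if_pos (not_lt.1 hc)]
        linarith [(hx i).1, not_lt.1 hc]
    linarith
  have hrb : ∀ i, (r (z i) : EReal) < b := by
    intro i
    by_contra hc
    have := key (fun t => if b ≤ (t : EReal) then -1 else 0)
    have hlt : ∀ j, b ≤ (r (z j) : EReal) → x j < r (z j) := fun j hj => by
      exact_mod_cast (hx j).2.trans_le hj
    have hpos : 0 < ∑ i, (fun t : ℝ => if b ≤ (t : EReal) then (-1:ℝ) else 0) (r (z i)) * (x i - r (z i)) := by
      refine Finset.sum_pos' (fun j _ => ?_) ⟨i, Finset.mem_univ i, ?_⟩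
      · dsimp only
        split_ifs with h
        · linarith [hlt j h]
        · simp
      · dsimp only
        rw [if_pos (not_lt.1 hc)]
        linarith [hlt i (not_lt.1 hc)]
    linarith
  have hfm : AEStronglyMeasurable (fun ω => f (r ω)) P := by
    obtain ⟨g', hg', hgS⟩ := exists_meas S f
    refine (hg'.comp hrm).aestronglyMeasurable.congr ?_
    filter_upwards [haeS] with ω hω using hgS _ hω
  have hab : ∀ᵐ ω ∂P, a ≤ r ω ∧ (r ω : EReal) ≤ b := by
    filter_upwards [haeS] with ω hω
    obtain ⟨i, _, hi⟩ := Finset.mem_image.1 hω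
    rw [← hi]
    exact ⟨(hra i).le, (hrb i).le⟩
  refine ⟨Q, hQp, ∫ ω, f (r ω) ∂P, ?_, ?_, hQint L hL.stronglyMeasurable⟩
  · rw [fDivOn, if_pos ⟨hQP, hab, emp_integrable hfm⟩]
  · rw [emp_integral hfm]
    refine mul_le_mul_of_nonneg_left ?_ hn0.le
    obtain ⟨g, hg⟩ := subgrad_aux _ hIo f hf_cvx
    calc ∑ i, f (r (z i)) = ∑ i, (f (r (z i)) + g (r (z i)) * (x i - r (z i))) := by
          rw [Finset.sum_add_distrib, key g, add_zero]
      _ ≤ _ := Finset.sum_le_sum fun i _ => hg _ ⟨hra i, hrb i⟩ _ (hx i)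

/-- Dual reformulation of the relaxed problem:
`inf_{Q : D_f(Q‖Pₙ) ≤ δ} {E_Q[ℒ] + κ D_f(Q‖Pₙ)}
  = sup_{λ>0, ρ∈ℝ} {−λδ − ρ − (λ+κ) E_{Pₙ}[f*(−(ℒ+ρ)/(λ+κ))]}`. -/
theorem relaxed_problem_dual_reformulation
    {𝒵 : Type*} [MeasurableSpace 𝒵] (n : ℕ) (hn : 0 < n) (z : Fin n → 𝒵)
    (a : ℝ) (b : EReal) (ha0 : 0 ≤ a) (ha1 : (a : EReal) < 1) (hb1 : (1 : EReal) < b)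
    (f : ℝ → ℝ) (hf_cvx : ConvexOn ℝ {x : ℝ | a < x ∧ (x : EReal) < b} f) (hf1 : f 1 = 0)
    (hfa : ContinuousWithinAt f (Set.Ioi a) a)
    (hfb : ∀ c : ℝ, b = (c : EReal) → ContinuousWithinAt f (Set.Iio c) c)
    (L : 𝒵 → ℝ) (hL : Measurable L)
    (δ : ℝ) (hδ : 0 < δ) (κ : ℝ) (hκ : 0 ≤ κ) :
    (⨅ Q : {Q : Measure 𝒵 // IsProbabilityMeasure Q ∧
        fDivOn a b f Q (empDist n z) ≤ (δ : EReal)},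
      ((∫ ζ, L ζ ∂(Q : Measure 𝒵) : ℝ) : EReal) + (κ : EReal) * fDivOn a b f Q (empDist n z))
    = ⨆ lam : {l : ℝ // 0 < l}, ⨆ ρ : ℝ,
        (((-((lam : ℝ) * δ) - ρ : ℝ)) : EReal)
          - (((lam : ℝ) + κ : ℝ) : EReal) *
            ((((n : ℝ)⁻¹ : ℝ) : EReal) *
              ∑ i : Fin n, fStarOn a b f (-(L (z i) + ρ) / ((lam : ℝ) + κ))) := by
  have hn0 : (n:ℝ) ≠ 0 := by positivity
  have hninv : (0:ℝ) ≤ (n:ℝ)⁻¹ := by positivity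
  have : NeZero n := ⟨hn.ne'⟩
  have hIo : IsOpen {x : ℝ | a < x ∧ (x : EReal) < b} :=
    (isOpen_lt continuous_const continuous_id).inter
      (isOpen_lt continuous_coe_real_ereal continuous_const)
  have h1I : (1:ℝ) ∈ {x : ℝ | a < x ∧ (x : EReal) < b} :=
    ⟨by exact_mod_cast ha1, by exact_mod_cast hb1⟩
  apply le_antisymm
  · rw [← EReal.ge_of_forall_gt_iff_ge]
    intro V hV
    have hV' : ∀ x : Fin n → ℝ, (∀ i, x i ∈ {x : ℝ | a < x ∧ (x : EReal) < b}) →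
        (n:ℝ)⁻¹ * ∑ i, x i = 1 → (n:ℝ)⁻¹ * ∑ i, f (x i) ≤ δ →
        V ≤ (n:ℝ)⁻¹ * ∑ i, (L (z i) * x i + κ * f (x i)) := by
      intro x hx hx1 hxδ
      obtain ⟨Q, hQ, d, hd, hdle, hQL⟩ := exists_Q n hn z a b ha0 f hIo hf_cvx L hL x hx hx1
      have := hV.le.trans (iInf_le _ ⟨Q, hQ, by rw [hd]; exact_mod_cast hdle.trans hxδ⟩)
      simp only [hd, hQL] at this
      have h2 : V ≤ (n:ℝ)⁻¹ * ∑ i, L (z i) * x i + κ * d := by exact_mod_cast this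
      refine h2.trans ?_
      rw [Finset.sum_add_distrib, ← Finset.mul_sum]
      have := mul_le_mul_of_nonneg_left hdle hκ
      linarith
    rw [← EReal.ge_of_forall_gt_iff_ge]
    intro W hW
    have hWV : W < V := by exact_mod_cast hW
    obtain ⟨lam, rho, hlam, H⟩ := strong_aux2 n _ hIo h1I f hf_cvx hf1 (fun i => L (z i)) hn δ κ V
      hδ hκ hV' (V - W) (by linarith)
    have hlk : 0 < lam + κ := by linarith
    obtain ⟨S, hS, hSB⟩ := sum_sup_aux n _ h1I
      (fun i t => -(L (z i) + rho) / (lam + κ) * t - f t)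
      ((-(lam * δ) - rho - V + (V - W)) / (lam + κ) * n) (fun x hx => by
        have := H x hx
        rw [← le_div_iff₀' hlk, inv_mul_le_iff₀ (by positivity)] at this
        linarith)
    refine le_trans ?_ (le_iSup_of_le ⟨lam, hlam⟩ (le_iSup _ rho))
    have hf : ∑ i : Fin n, fStarOn a b f (-(L (z i) + rho) / (lam + κ)) ≤ ((∑ i, S i : ℝ) : EReal) := by
      rw [ereal_coe_sum]
      refine Finset.sum_le_sum fun i _ => iSup_le fun t => ?_
      exact_mod_cast hS i t t.2
    have h3 : (((lam + κ : ℝ)) : EReal) * ((((n : ℝ)⁻¹ : ℝ) : EReal) *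
        ∑ i : Fin n, fStarOn a b f (-(L (z i) + rho) / (lam + κ)))
        ≤ ((lam + κ : ℝ) : EReal) * ((((n : ℝ)⁻¹ : ℝ) : EReal) * ((∑ i, S i : ℝ) : EReal)) :=
      mul_le_mul_of_nonneg_left (mul_le_mul_of_nonneg_left hf (by exact_mod_cast hninv))
        (by exact_mod_cast hlk.le)
    refine le_trans ?_ (EReal.sub_le_sub le_rfl h3)
    rw [← EReal.coe_mul, ← EReal.coe_mul, ← EReal.coe_sub, EReal.coe_le_coe_iff]
    have h4 : (n:ℝ)⁻¹ * ∑ i, S i ≤ (-(lam * δ) - rho - V + (V - W)) / (lam + κ) := by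
      rw [inv_mul_le_iff₀ (by positivity)]; linarith
    rw [le_div_iff₀' hlk] at h4
    simp only
    linarith
  · refine iSup_le fun lam => iSup_le fun rho => le_iInf fun Q => ?_
    obtain ⟨lam, hlam⟩ := lam
    obtain ⟨Q, hQ, hD⟩ := Q
    simp only
    have hcond : Q ≪ empDist n z ∧ (∀ᵐ ω ∂(empDist n z), a ≤ ((Q.rnDeriv (empDist n z)) ω).toReal ∧
        (((Q.rnDeriv (empDist n z)) ω).toReal : EReal) ≤ b)
        ∧ Integrable (fun ω => f ((Q.rnDeriv (empDist n z)) ω).toReal) (empDist n z) := by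
      by_contra hc
      rw [fDivOn, if_neg hc] at hD
      simp at hD
    rw [fDivOn, if_pos hcond] at hD ⊢
    obtain ⟨hQP, hab, hint⟩ := hcond
    rw [emp_integral hint.aestronglyMeasurable] at hD ⊢
    have hrm : Measurable fun ω => (Q.rnDeriv (empDist n z) ω).toReal :=
      (Measure.measurable_rnDeriv Q _).ennreal_toReal
    have hLint := integral_rnDeriv_smul (f := L) hQP
    rw [emp_integral (by exact (hrm.mul hL).aestronglyMeasurable)] at hLint
    have h1int := integral_rnDeriv_smul (f := fun _ => (1:ℝ)) hQP
    rw [emp_integral (by exact (hrm.mul measurable_const).aestronglyMeasurable)] at h1int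
    simp only [smul_eq_mul, mul_one, integral_const, probReal_univ] at h1int
    rw [← hLint]
    have hab' := emp_ae hab
    set x : Fin n → ℝ := fun i => (Q.rnDeriv (empDist n z) (z i)).toReal with hx
    have hD' : (n:ℝ)⁻¹ * ∑ i, f (x i) ≤ δ := by exact_mod_cast hD
    have hlk : 0 < lam + κ := by linarith
    have hf : ((∑ i, (-(L (z i) + rho) / (lam + κ) * x i - f (x i)) : ℝ) : EReal) ≤
        ∑ i : Fin n, fStarOn a b f (-(L (z i) + rho) / (lam + κ)) := by
      rw [ereal_coe_sum]
      exact Finset.sum_le_sum fun i _ => fStar_ge a b ha1 hb1 f hfa hfb _ _ (hab' i).1 (hab' i).2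
    have h3 := mul_le_mul_of_nonneg_left (mul_le_mul_of_nonneg_left hf
      (show (0:EReal) ≤ (((n : ℝ)⁻¹ : ℝ) : EReal) by exact_mod_cast hninv))
        (show (0:EReal) ≤ ((lam + κ : ℝ) : EReal) by exact_mod_cast hlk.le)
    refine (EReal.sub_le_sub le_rfl h3).trans ?_
    rw [← EReal.coe_mul, ← EReal.coe_mul, ← EReal.coe_sub, ← EReal.coe_mul, ← EReal.coe_add,
      EReal.coe_le_coe_iff]
    have h5 : (lam + κ) * ((n:ℝ)⁻¹ * ∑ i, (-(L (z i) + rho) / (lam + κ) * x i - f (x i)))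
        = -((n:ℝ)⁻¹ * ∑ i, x i • L (z i)) - rho * ((n:ℝ)⁻¹ * ∑ i, x i)
          - (lam + κ) * ((n:ℝ)⁻¹ * ∑ i, f (x i)) := by
      simp only [Finset.mul_sum, ← Finset.sum_neg_distrib, ← Finset.sum_sub_distrib, smul_eq_mul]
      refine Finset.sum_congr rfl fun i _ => ?_
      field_simp
      ring
    rw [h5, h1int]
    have := mul_le_mul_of_nonneg_left hD' hlam.le
    simp only [hx] at this ⊢
    nlinarith
end

section
/- Let ℒ : 𝒵 → ℝ be measurable and let P_n be the empirical distribution of points z_1, …, z_n ∈ 𝒵. Then for all δ > 0 and κ ≥ 0: inf_{Q : KL(Q‖P_n) ≤ δ} { E_Q[ℒ] + κ KL(Q‖P_n) } = sup_{λ > 0} { −λδ − (λ + κ) log E_{P_n}[ exp( −ℒ/(λ + κ) ) ] }. -/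
open MeasureTheory Classical
open scoped ENNReal BigOperators

/-- The KL divergence `KL(Q ‖ P) = E_P[(dQ/dP) log(dQ/dP)]` when `Q ≪ P` (and the integrand
is integrable), and `∞` otherwise, valued in the extended reals.  (Note `t log t` continuously
extends by `0` at `t = 0`, consistently with `Real.log 0 = 0`.) -/
noncomputable def klDiv' {Ω : Type*} [MeasurableSpace Ω] (Q P : Measure Ω) : EReal :=
  if Q ≪ P ∧ Integrable
      (fun ω => ((Q.rnDeriv P) ω).toReal * Real.log ((Q.rnDeriv P) ω).toReal) P
  then ((∫ ω, ((Q.rnDeriv P) ω).toReal * Real.log ((Q.rnDeriv P) ω).toReal ∂P : ℝ) : EReal)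
  else ⊤

lemma int_emp {𝒵 : Type*} [MeasurableSpace 𝒵] (n : ℕ) (z : Fin n → 𝒵)
    (g : 𝒵 → ℝ) (hg : Measurable g) :
    (n ≠ 0 → Integrable g (empDist n z)) ∧
      ∫ x, g x ∂(empDist n z) = (n : ℝ)⁻¹ * ∑ i, g (z i) := by
  have hd : ∀ i, Integrable g (Measure.dirac (z i)) := fun i => by
    have h0 : Integrable (fun _ : 𝒵 => g (z i)) (Measure.dirac (z i)) := integrable_const _
    refine h0.congr ?_
    rw [Filter.EventuallyEq, ae_dirac_iff]
    exact measurableSet_eq_fun measurable_const hg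
  constructor
  · intro hn
    unfold empDist
    refine Integrable.smul_measure ?_ (by simp [hn])
    exact integrable_finsetSum_measure.2 fun i _ => hd i
  · unfold empDist
    rw [integral_smul_measure, integral_finsetSum_measure fun i _ => hd i]
    simp [integral_dirac' _ _ hg.stronglyMeasurable]

lemma emp_prob {𝒵 : Type*} [MeasurableSpace 𝒵] (n : ℕ) (hn : 0 < n) (z : Fin n → 𝒵) :
    IsProbabilityMeasure (empDist n z) := by
  constructor
  simp only [empDist, Measure.smul_apply, Measure.finsetSum_apply, measure_univ, smul_eq_mul]
  simp only [Finset.sum_const, Finset.card_univ, Fintype.card_fin, nsmul_eq_mul, mul_one]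
  exact ENNReal.inv_mul_cancel (by simp; omega) (by simp)

lemma ptwise (r a : ℝ) (hr : 0 ≤ r) (ha : 0 < a) :
    r * Real.log a + r - a ≤ r * Real.log r := by
  rcases hr.eq_or_lt with h | h
  · subst h; simp; linarith
  · have := Real.log_le_sub_one_of_pos (div_pos ha h)
    rw [Real.log_div ha.ne' h.ne'] at this
    have h2 := mul_le_mul_of_nonneg_left this hr
    have : r * (a / r - 1) = a - r := by field_simp
    nlinarith

lemma Zpos (n : ℕ) (hn : 0 < n) (l : Fin n → ℝ) (t : ℝ) :
    0 < (n : ℝ)⁻¹ * ∑ i, Real.exp (-(l i) / t) := by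
  have : Nonempty (Fin n) := ⟨⟨0, hn⟩⟩
  have : 0 < ∑ i, Real.exp (-(l i) / t) :=
    Finset.sum_pos (fun i _ => Real.exp_pos _) Finset.univ_nonempty
  positivity

lemma gibbs (n : ℕ) (hn : 0 < n) (l r : Fin n → ℝ) (hr : ∀ i, 0 ≤ r i)
    (h1 : (n : ℝ)⁻¹ * ∑ i, r i = 1) (t : ℝ) (ht : 0 < t) :
    - (t * Real.log ((n : ℝ)⁻¹ * ∑ i, Real.exp (-(l i) / t))) ≤
      (n : ℝ)⁻¹ * ∑ i, r i * l i + t * ((n : ℝ)⁻¹ * ∑ i, r i * Real.log (r i)) := by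
  have hZ := Zpos n hn l t
  set Z := (n : ℝ)⁻¹ * ∑ i, Real.exp (-(l i) / t) with hZd
  have hp : ∀ i, r i * (-(l i) / t - Real.log Z) + r i - Real.exp (-(l i) / t) / Z
      ≤ r i * Real.log (r i) := fun i => by
    have := ptwise (r i) (Real.exp (-(l i) / t) / Z) (hr i) (by positivity)
    rwa [Real.log_div (Real.exp_pos _).ne' hZ.ne', Real.log_exp] at this
  have hs := Finset.sum_le_sum (s := Finset.univ) fun i _ => hp i
  have hn' : (0 : ℝ) < (n : ℝ)⁻¹ := by positivity
  have hs2 := mul_le_mul_of_nonneg_left hs hn'.le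
  have e : (n : ℝ)⁻¹ * ∑ i, (r i * (-(l i) / t - Real.log Z) + r i - Real.exp (-(l i) / t) / Z)
      = - ((n : ℝ)⁻¹ * ∑ i, r i * l i) / t - Real.log Z * ((n : ℝ)⁻¹ * ∑ i, r i)
        + (n : ℝ)⁻¹ * ∑ i, r i - Z / Z := by
    have hZZ : Z / Z = ((n : ℝ)⁻¹ * ∑ i, Real.exp (-(l i) / t)) / Z := by rw [← hZd]
    rw [hZZ]
    clear_value Z
    simp only [Finset.mul_sum, Finset.sum_div, neg_div, ← Finset.sum_neg_distrib,
      ← Finset.sum_sub_distrib, ← Finset.sum_add_distrib]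
    refine Finset.sum_congr rfl fun i _ => ?_
    ring
  rw [e, h1, div_self hZ.ne'] at hs2
  have h3 := mul_le_mul_of_nonneg_left hs2 ht.le
  have e2 : t * (-((n : ℝ)⁻¹ * ∑ i, r i * l i) / t - Real.log Z * 1 + 1 - 1) =
    - ((n : ℝ)⁻¹ * ∑ i, r i * l i) - t * Real.log Z := by field_simp; ring
  linarith

lemma kl_eq {𝒵 : Type*} [MeasurableSpace 𝒵] (n : ℕ) (hn : 0 < n) (z : Fin n → 𝒵)
    (Q : Measure 𝒵) (hQ : Q ≪ empDist n z) :
    klDiv' Q (empDist n z) = (((n : ℝ)⁻¹ * ∑ i, ((Q.rnDeriv (empDist n z)) (z i)).toReal *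
      Real.log ((Q.rnDeriv (empDist n z)) (z i)).toReal : ℝ) : EReal) := by
  have hm : Measurable fun ω => ((Q.rnDeriv (empDist n z)) ω).toReal *
      Real.log ((Q.rnDeriv (empDist n z)) ω).toReal := by
    have := (Measure.measurable_rnDeriv Q (empDist n z)).ennreal_toReal
    fun_prop
  have := int_emp n z _ hm
  unfold klDiv'
  rw [if_pos ⟨hQ, this.1 hn.ne'⟩, this.2]

lemma kl_ac {𝒵 : Type*} [MeasurableSpace 𝒵] (P Q : Measure 𝒵) (δ : ℝ)
    (h : klDiv' Q P ≤ (δ : EReal)) : Q ≪ P := by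
  by_contra hc
  unfold klDiv' at h
  rw [if_neg (fun h => hc h.1)] at h
  simp at h

lemma weak {𝒵 : Type*} [MeasurableSpace 𝒵] (n : ℕ) (hn : 0 < n) (z : Fin n → 𝒵)
    (L : 𝒵 → ℝ) (hL : Measurable L) (δ : ℝ) (κ : ℝ) (hκ : 0 ≤ κ)
    (Q : Measure 𝒵) (hQ : IsProbabilityMeasure Q) (hk : klDiv' Q (empDist n z) ≤ (δ : EReal))
    (lam : ℝ) (hl : 0 < lam) :
    (((-(lam * δ) - (lam + κ) *
          Real.log ((n : ℝ)⁻¹ * ∑ i : Fin n, Real.exp (-(L (z i)) / (lam + κ))) : ℝ)) : EReal)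
    ≤ ((∫ ζ, L ζ ∂Q : ℝ) : EReal) + (κ : EReal) * klDiv' Q (empDist n z) := by
  have hac := kl_ac _ _ _ hk
  have := emp_prob n hn z
  rw [kl_eq n hn z Q hac] at hk ⊢
  have hm := (Measure.measurable_rnDeriv Q (empDist n z)).ennreal_toReal
  have hE : ∫ ζ, L ζ ∂Q = (n : ℝ)⁻¹ * ∑ i, ((Q.rnDeriv (empDist n z)) (z i)).toReal * L (z i) := by
    rw [← integral_rnDeriv_smul hac]
    exact (int_emp n z _ (hm.mul hL)).2
  have h1 : (n : ℝ)⁻¹ * ∑ i, ((Q.rnDeriv (empDist n z)) (z i)).toReal = 1 := by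
    rw [← (int_emp n z _ hm).2, Measure.integral_toReal_rnDeriv hac]
    simp
  have hg := gibbs n hn (fun i => L (z i)) (fun i => ((Q.rnDeriv (empDist n z)) (z i)).toReal)
    (fun i => ENNReal.toReal_nonneg) h1 (lam + κ) (by linarith)
  rw [hE, ← EReal.coe_mul, ← EReal.coe_add, EReal.coe_le_coe_iff]
  rw [EReal.coe_le_coe_iff] at hk
  have := mul_le_mul_of_nonneg_left hk hl.le
  linarith

/-- Tilted density. -/
noncomputable def tlt {n : ℕ} (l : Fin n → ℝ) (t x : ℝ) : ℝ :=
  Real.exp (-x / t) / ((n : ℝ)⁻¹ * ∑ i, Real.exp (-(l i) / t))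

/-- Entropy of the tilted density. -/
noncomputable def tk {n : ℕ} (l : Fin n → ℝ) (t : ℝ) : ℝ :=
  (n : ℝ)⁻¹ * ∑ i, tlt l t (l i) * Real.log (tlt l t (l i))

lemma tlt_mean {n : ℕ} (hn : 0 < n) (l : Fin n → ℝ) (t : ℝ) :
    (n : ℝ)⁻¹ * ∑ i, tlt l t (l i) = 1 := by
  unfold tlt
  rw [← Finset.sum_div, ← mul_div_assoc, div_self (Zpos n hn l t).ne']

lemma tlt_pos {n : ℕ} (hn : 0 < n) (l : Fin n → ℝ) (t x : ℝ) : 0 < tlt l t x :=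
  div_pos (Real.exp_pos _) (Zpos n hn l t)

lemma tk_nonneg {n : ℕ} (hn : 0 < n) (l : Fin n → ℝ) (t : ℝ) : 0 ≤ tk l t := by
  have := gibbs n hn (fun _ => 0) (fun i => tlt l t (l i)) (fun i => (tlt_pos hn l t _).le)
    (tlt_mean hn l t) 1 one_pos
  have hn' : (n : ℝ) ≠ 0 := by positivity
  simpa [tk, hn'] using this

lemma tk_cont {n : ℕ} (hn : 0 < n) (l : Fin n → ℝ) : ContinuousOn (tk l) (Set.Ioi 0) := by
  have h : ∀ i, ContinuousOn (fun t => tlt l t (l i)) (Set.Ioi 0) := fun i => by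
    unfold tlt
    have he : ∀ x : ℝ, ContinuousOn (fun t : ℝ => Real.exp (-x / t)) (Set.Ioi 0) := fun x =>
      (continuousOn_const.div continuousOn_id (fun t ht => (ne_of_gt ht))).rexp
    refine (he _).div (continuousOn_const.mul (continuousOn_finsetSum _ fun j _ => he _)) ?_
    exact fun t _ => (Zpos n hn l t).ne'
  unfold tk
  exact continuousOn_const.mul (continuousOn_finsetSum _ fun j _ =>
    (h j).mul ((h j).log fun t _ => (tlt_pos hn l t _).ne'))

lemma tk_lim {n : ℕ} (hn : 0 < n) (l : Fin n → ℝ) :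
    Filter.Tendsto (tk l) Filter.atTop (nhds 0) := by
  have hn' : (n : ℝ) ≠ 0 := by positivity
  have he : ∀ x : ℝ, Filter.Tendsto (fun t : ℝ => Real.exp (-x / t)) Filter.atTop (nhds 1) :=
    fun x => by
      have := (Real.continuous_exp.tendsto 0).comp
        (Filter.Tendsto.const_div_atTop (r := -x) Filter.tendsto_id)
      simpa [Function.comp_def] using this
  have h : ∀ i, Filter.Tendsto (fun t => tlt l t (l i)) Filter.atTop (nhds 1) := fun i => by
    unfold tlt
    have hs : Filter.Tendsto (fun t : ℝ => (n : ℝ)⁻¹ * ∑ i, Real.exp (-(l i) / t))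
        Filter.atTop (nhds 1) := by
      have := (tendsto_finsetSum Finset.univ fun i _ => he (l i)).const_mul ((n : ℝ)⁻¹)
      simpa [hn'] using this
    simpa [Pi.div_def] using (he (l i)).div hs one_ne_zero
  have := (tendsto_finsetSum Finset.univ fun i _ =>
    (h i).mul ((h i).log one_ne_zero)).const_mul ((n : ℝ)⁻¹)
  unfold tk
  simpa using this

lemma tilt_meas {𝒵 : Type*} [MeasurableSpace 𝒵] (n : ℕ) (hn : 0 < n) (z : Fin n → 𝒵)
    (L : 𝒵 → ℝ) (hL : Measurable L) (t : ℝ) (ht : 0 < t) :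
    ∃ Q : Measure 𝒵, IsProbabilityMeasure Q ∧
      klDiv' Q (empDist n z) = ((tk (fun i => L (z i)) t : ℝ) : EReal) ∧
      ∫ ζ, L ζ ∂Q = - t * Real.log ((n : ℝ)⁻¹ * ∑ i : Fin n, Real.exp (-(L (z i)) / t))
        - t * tk (fun i => L (z i)) t := by
  have hP := emp_prob n hn z
  set l : Fin n → ℝ := fun i => L (z i) with hl
  set f : 𝒵 → ℝ := fun x => tlt l t (L x) with hf
  have hfm : Measurable f := by
    simp only [hf, tlt]
    fun_prop
  have hfpos : ∀ x, 0 < f x := fun x => tlt_pos hn l t _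
  set Q := (empDist n z).withDensity (fun x => ENNReal.ofReal (f x)) with hQ
  have hac : Q ≪ empDist n z := withDensity_absolutelyContinuous _ _
  have hrn : Q.rnDeriv (empDist n z) =ᵐ[empDist n z] fun x => ENNReal.ofReal (f x) :=
    Measure.rnDeriv_withDensity _ hfm.ennreal_ofReal
  have hfi := int_emp n z f hfm
  refine ⟨Q, ?_, ?_, ?_⟩
  · constructor
    rw [hQ, withDensity_apply _ MeasurableSet.univ, Measure.restrict_univ,
      ← ofReal_integral_eq_lintegral_ofReal (hfi.1 hn.ne') (Filter.Eventually.of_forall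
        fun x => (hfpos x).le), hfi.2]
    have := tlt_mean hn l t
    simp only [hf]
    rw [show (n : ℝ)⁻¹ * ∑ i, tlt l t (L (z i)) = 1 from this]
    simp
  · have hm : Measurable fun ω => f ω * Real.log (f ω) := by fun_prop
    have hi := int_emp n z _ hm
    have hc : (fun ω => ((Q.rnDeriv (empDist n z)) ω).toReal *
        Real.log ((Q.rnDeriv (empDist n z)) ω).toReal) =ᵐ[empDist n z]
        fun ω => f ω * Real.log (f ω) := by
      filter_upwards [hrn] with x hx
      rw [hx, ENNReal.toReal_ofReal (hfpos x).le]
    unfold klDiv'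
    rw [if_pos ⟨hac, (hi.1 hn.ne').congr hc.symm⟩, integral_congr_ae hc, hi.2]
    rfl
  · have hE : ∫ ζ, L ζ ∂Q = (n : ℝ)⁻¹ * ∑ i, f (z i) * L (z i) := by
      rw [hQ, integral_withDensity_eq_integral_toReal_smul hfm.ennreal_ofReal (by simp)]
      simp only [ENNReal.toReal_ofReal (hfpos _).le, smul_eq_mul]
      exact (int_emp n z _ (hfm.mul hL)).2
    rw [hE]
    have hZ := Zpos n hn l t
    have hlog : ∀ i, L (z i) = - t * Real.log ((n : ℝ)⁻¹ * ∑ i : Fin n, Real.exp (-(l i) / t))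
        - t * Real.log (f (z i)) := fun i => by
      simp only [hf, tlt]
      rw [Real.log_div (Real.exp_pos _).ne' hZ.ne', Real.log_exp]
      field_simp
      ring
    set W := Real.log ((n : ℝ)⁻¹ * ∑ i : Fin n, Real.exp (-(l i) / t)) with hW
    have h1 : (n : ℝ)⁻¹ * ∑ i, f (z i) = 1 := tlt_mean hn l t
    have h2 : tk l t = (n : ℝ)⁻¹ * ∑ i, f (z i) * Real.log (f (z i)) := rfl
    rw [h2, Finset.sum_congr rfl fun i _ => by rw [hlog i]]
    calc _ = -t * W * ((n : ℝ)⁻¹ * ∑ i, f (z i))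
        - t * ((n : ℝ)⁻¹ * ∑ i, f (z i) * Real.log (f (z i))) := by
          simp only [Finset.mul_sum, ← Finset.sum_sub_distrib]
          refine Finset.sum_congr rfl fun i _ => ?_
          ring
      _ = _ := by rw [h1, mul_one]


/-- Dual reformulation in the KL case:
`inf_{Q : KL(Q‖Pₙ) ≤ δ} {E_Q[ℒ] + κ KL(Q‖Pₙ)}
  = sup_{λ>0} {−λδ − (λ+κ) log E_{Pₙ}[exp(−ℒ/(λ+κ))]}`. -/
theorem relaxed_problem_dual_reformulation_KL
    {𝒵 : Type*} [MeasurableSpace 𝒵] (n : ℕ) (hn : 0 < n) (z : Fin n → 𝒵)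
    (L : 𝒵 → ℝ) (hL : Measurable L)
    (δ : ℝ) (hδ : 0 < δ) (κ : ℝ) (hκ : 0 ≤ κ) :
    (⨅ Q : {Q : Measure 𝒵 // IsProbabilityMeasure Q ∧
        klDiv' Q (empDist n z) ≤ (δ : EReal)},
      ((∫ ζ, L ζ ∂(Q : Measure 𝒵) : ℝ) : EReal) + (κ : EReal) * klDiv' Q (empDist n z))
    = ⨆ lam : {l : ℝ // 0 < l},
        (((-((lam : ℝ) * δ) - ((lam : ℝ) + κ) *
          Real.log ((n : ℝ)⁻¹ * ∑ i : Fin n, Real.exp (-(L (z i)) / ((lam : ℝ) + κ))) : ℝ)) :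
            EReal) := by
 
  apply le_antisymm
  · set l : Fin n → ℝ := fun i => L (z i) with hl
    set S := ⨆ lam : {l : ℝ // 0 < l},
        (((-((lam : ℝ) * δ) - ((lam : ℝ) + κ) *
          Real.log ((n : ℝ)⁻¹ * ∑ i : Fin n, Real.exp (-(L (z i)) / ((lam : ℝ) + κ))) : ℝ)) :
            EReal) with hS
    have hDS : ∀ lam : ℝ, 0 < lam → (((-(lam * δ) - (lam + κ) *
          Real.log ((n : ℝ)⁻¹ * ∑ i : Fin n, Real.exp (-(L (z i)) / (lam + κ))) : ℝ)) :
            EReal) ≤ S := fun lam h => le_iSup (fun lam : {l : ℝ // 0 < l} =>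
        (((-((lam : ℝ) * δ) - ((lam : ℝ) + κ) *
          Real.log ((n : ℝ)⁻¹ * ∑ i : Fin n, Real.exp (-(L (z i)) / ((lam : ℝ) + κ))) : ℝ)) :
            EReal)) ⟨lam, h⟩
    -- upper bound on the infimum by tilted measures
    have key : ∀ lam : ℝ, 0 < lam → tk l (lam + κ) ≤ δ →
        (⨅ Q : {Q : Measure 𝒵 // IsProbabilityMeasure Q ∧
          klDiv' Q (empDist n z) ≤ (δ : EReal)},
          ((∫ ζ, L ζ ∂(Q : Measure 𝒵) : ℝ) : EReal) + (κ : EReal) * klDiv' Q (empDist n z))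
        ≤ (((-(lam * δ) - (lam + κ) *
          Real.log ((n : ℝ)⁻¹ * ∑ i : Fin n, Real.exp (-(L (z i)) / (lam + κ)))
            + lam * (δ - tk l (lam + κ)) : ℝ)) : EReal) := by
      intro lam h hk
      obtain ⟨Q, hQ, hQk, hQE⟩ := tilt_meas n hn z L hL (lam + κ) (by linarith)
      have hQd : klDiv' Q (empDist n z) ≤ (δ : EReal) := by
        rw [hQk]; exact_mod_cast hk
      refine (iInf_le _ ⟨Q, hQ, hQd⟩).trans ?_
      · simp only [hQk, hQE]
        rw [← EReal.coe_mul, ← EReal.coe_add, EReal.coe_le_coe_iff]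
        apply le_of_eq
        ring
    by_cases hex : ∃ lam : ℝ, 0 < lam ∧ tk l (lam + κ) = δ
    · obtain ⟨lam, h, hk⟩ := hex
      refine (key lam h hk.le).trans ?_
      rw [hk, sub_self, mul_zero, add_zero]
      exact hDS lam h
    · have hlt : ∀ lam : ℝ, 0 < lam → tk l (lam + κ) < δ := by
        intro lam h
        by_contra hc
        push Not at hc
        obtain ⟨T, hT1, hT2⟩ := (((tk_lim hn l).eventually (gt_mem_nhds hδ)).and
          (Filter.eventually_ge_atTop (lam + κ))).exists
        have hcont : ContinuousOn (tk l) (Set.Icc (lam + κ) T) :=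
          (tk_cont hn l).mono fun x hx => by
            have := hx.1
            simp only [Set.mem_Ioi]; linarith
        obtain ⟨s, hs, hs2⟩ := intermediate_value_Icc' hT2 hcont ⟨hT1.le, hc⟩
        exact hex ⟨s - κ, by linarith [hs.1], by rw [sub_add_cancel]; exact hs2⟩
      refine EReal.le_of_forall_lt_iff_le.1 fun c hc => ?_
      obtain ⟨s, hs1, hs2⟩ := EReal.lt_iff_exists_real_btwn.1 hc
      have hs2' : s < c := by exact_mod_cast hs2
      have hpos : 0 < (c - s) / δ := div_pos (by linarith) hδ
      refine (key _ hpos (hlt _ hpos).le).trans ?_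
      have h1 := (hDS _ hpos).trans hs1.le
      rw [EReal.coe_le_coe_iff] at h1 ⊢
      have h2 := mul_nonneg hpos.le (tk_nonneg hn l ((c - s) / δ + κ))
      have h3 : (c - s) / δ * δ = c - s := by field_simp
      linarith
  · exact iSup_le fun lam => le_iInf fun Q =>
      weak n hn z L hL δ κ hκ Q.1 Q.2.1 Q.2.2 lam.1 lam.2
end

section
/- Let 0 ≤ a < 1 < b ≤ ∞, let f : (a,b) → ℝ be convex with f(1) = 0, let ℒ : 𝒵 → ℝ be measurable, let P_n be the empirical distribution of points z_1, …, z_n ∈ 𝒵, and let δ > 0, κ ≥ 0. Then the function (λ, ρ) ↦ −λδ − ρ − (λ + κ) E_{P_n}[ f*( −(ℒ + ρ)/(λ + κ) ) ] is concave on (0,∞) × ℝ, where f* is the Legendre transform of f. -/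
open MeasureTheory Classical
open scoped ENNReal BigOperators

/-- The dual objective
`G(λ, ρ) = −λδ − ρ − (λ+κ) E_{Pₙ}[f*(−(ℒ+ρ)/(λ+κ))]`,
where `E_{Pₙ}[g] = (1/n) ∑ᵢ g(zᵢ)` is the expectation under the empirical distribution. -/
noncomputable def dualObjective {𝒵 : Type*} (n : ℕ) (z : Fin n → 𝒵)
    (a : ℝ) (b : EReal) (f : ℝ → ℝ) (L : 𝒵 → ℝ) (δ κ : ℝ) (p : ℝ × ℝ) : EReal :=
  (((-(p.1 * δ) - p.2 : ℝ)) : EReal)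
    - ((p.1 + κ : ℝ) : EReal) *
      ((((n : ℝ)⁻¹ : ℝ) : EReal) *
        ∑ i : Fin n, fStarOn a b f (-(L (z i) + p.2) / (p.1 + κ)))

theorem aux_coe_sum {n : ℕ} (s : Finset (Fin n)) (u : Fin n → ℝ) :
    ((∑ i ∈ s, u i : ℝ) : EReal) = ∑ i ∈ s, ((u i : ℝ) : EReal) := by
  induction s using Finset.induction_on with
  | empty => simp
  | insert i s hi ih => rw [Finset.sum_insert hi, Finset.sum_insert hi, EReal.coe_add, ih]

theorem aux_ge (a : ℝ) (b : EReal) (f : ℝ → ℝ) (y x : ℝ) (h1 : a < x) (h2 : (x : EReal) < b) :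
    ((y * x - f x : ℝ) : EReal) ≤ fStarOn a b f y :=
  le_iSup (fun x : {x : ℝ // a < x ∧ (x : EReal) < b} =>
    ((y * (x : ℝ) - f x : ℝ) : EReal)) ⟨x, h1, h2⟩

theorem aux_lower {𝒵 : Type*} (n : ℕ) (z : Fin n → 𝒵)
    (a : ℝ) (b : EReal) (f : ℝ → ℝ) (L : 𝒵 → ℝ) (δ κ : ℝ) (p : ℝ × ℝ) (hp : 0 ≤ p.1 + κ)
    (w : Fin n → ℝ)
    (hw : ∀ i, fStarOn a b f (-(L (z i) + p.2) / (p.1 + κ)) ≤ (w i : EReal)) :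
    (((-(p.1 * δ) - p.2) - (p.1 + κ) * ((n : ℝ)⁻¹ * ∑ i, w i) : ℝ) : EReal)
      ≤ dualObjective n z a b f L δ κ p := by
  unfold dualObjective
  rw [EReal.coe_sub, EReal.coe_mul, EReal.coe_mul, aux_coe_sum]
  refine EReal.sub_le_sub le_rfl ?_
  refine mul_le_mul_of_nonneg_left ?_ (EReal.coe_nonneg.2 hp)
  refine mul_le_mul_of_nonneg_left ?_ (EReal.coe_nonneg.2 (by positivity))
  exact Finset.sum_le_sum fun i _ => hw i

theorem aux_eq {𝒵 : Type*} (n : ℕ) (z : Fin n → 𝒵)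
    (a : ℝ) (b : EReal) (f : ℝ → ℝ) (L : 𝒵 → ℝ) (δ κ : ℝ) (p : ℝ × ℝ)
    (w : Fin n → ℝ)
    (hw : ∀ i, fStarOn a b f (-(L (z i) + p.2) / (p.1 + κ)) = (w i : EReal)) :
    dualObjective n z a b f L δ κ p =
    (((-(p.1 * δ) - p.2) - (p.1 + κ) * ((n : ℝ)⁻¹ * ∑ i, w i) : ℝ) : EReal) := by
  unfold dualObjective
  simp only [hw]
  rw [EReal.coe_sub (_ - _) (_ * _), EReal.coe_mul, EReal.coe_mul, aux_coe_sum]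

theorem aux_bot {𝒵 : Type*} (n : ℕ) (hn : 0 < n) (z : Fin n → 𝒵)
    (a : ℝ) (b : EReal) (ha1 : (a : EReal) < 1) (hb1 : (1 : EReal) < b)
    (f : ℝ → ℝ) (L : 𝒵 → ℝ) (δ κ : ℝ) (p : ℝ × ℝ) (hp : 0 < p.1 + κ) (i : Fin n)
    (hi : fStarOn a b f (-(L (z i) + p.2) / (p.1 + κ)) = ⊤) :
    dualObjective n z a b f L δ κ p = ⊥ := by
  have hs : ∑ i : Fin n, fStarOn a b f (-(L (z i) + p.2) / (p.1 + κ)) = ⊤ := by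
    rw [← Finset.add_sum_erase _ _ (Finset.mem_univ i), hi]
    refine EReal.top_add_of_ne_bot ?_
    have h := Finset.sum_le_sum (s := Finset.univ.erase i) fun j _ =>
      aux_ge a b f (-(L (z j) + p.2) / (p.1 + κ)) 1 (by exact_mod_cast ha1) (by exact_mod_cast hb1)
    rw [← aux_coe_sum] at h
    exact ne_of_gt (lt_of_lt_of_le (EReal.bot_lt_coe _) h)
  unfold dualObjective
  rw [hs, EReal.coe_mul_top_of_pos (by positivity), EReal.coe_mul_top_of_pos hp]
  rw [sub_eq_add_neg, EReal.neg_top, EReal.add_bot]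

theorem aux_real {𝒵 : Type*} (n : ℕ) (hn : 0 < n) (z : Fin n → 𝒵)
    (a : ℝ) (b : EReal) (ha1 : (a : EReal) < 1) (hb1 : (1 : EReal) < b)
    (f : ℝ → ℝ) (L : 𝒵 → ℝ) (δ κ : ℝ) (p : ℝ × ℝ) (hp : 0 < p.1 + κ) :
    dualObjective n z a b f L δ κ p = ⊥ ∨
    ∃ w : Fin n → ℝ, ∀ i, fStarOn a b f (-(L (z i) + p.2) / (p.1 + κ)) = (w i : EReal) := by
  by_cases h : ∃ i, fStarOn a b f (-(L (z i) + p.2) / (p.1 + κ)) = ⊤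
  · obtain ⟨i, hi⟩ := h
    exact Or.inl (aux_bot n hn z a b ha1 hb1 f L δ κ p hp i hi)
  · right
    push Not at h
    refine ⟨fun i => (fStarOn a b f (-(L (z i) + p.2) / (p.1 + κ))).toReal, fun i => ?_⟩
    refine (EReal.coe_toReal (h i) ?_).symm
    exact ne_of_gt (lt_of_lt_of_le (EReal.bot_lt_coe _)
      (aux_ge a b f _ 1 (by exact_mod_cast ha1) (by exact_mod_cast hb1)))

/-- The dual objective
`(λ, ρ) ↦ −λδ − ρ − (λ+κ) E_{Pₙ}[f*(−(ℒ+ρ)/(λ+κ))]`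
is concave on `(0,∞) × ℝ` (as an extended-real-valued function). -/
theorem dual_objective_concave
    {𝒵 : Type*} [MeasurableSpace 𝒵] (n : ℕ) (hn : 0 < n) (z : Fin n → 𝒵)
    (a : ℝ) (b : EReal) (ha0 : 0 ≤ a) (ha1 : (a : EReal) < 1) (hb1 : (1 : EReal) < b)
    (f : ℝ → ℝ) (hf_cvx : ConvexOn ℝ {x : ℝ | a < x ∧ (x : EReal) < b} f) (hf1 : f 1 = 0)
    (L : 𝒵 → ℝ) (hL : Measurable L)
    (δ : ℝ) (hδ : 0 < δ) (κ : ℝ) (hκ : 0 ≤ κ) :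
    ∀ p q : ℝ × ℝ, 0 < p.1 → 0 < q.1 → ∀ t : ℝ, 0 ≤ t → t ≤ 1 →
      (t : EReal) * dualObjective n z a b f L δ κ p
          + ((1 - t : ℝ) : EReal) * dualObjective n z a b f L δ κ q
        ≤ dualObjective n z a b f L δ κ (t • p + (1 - t) • q) := by
  intro p q hp hq t ht0 ht1
  rcases ht0.eq_or_lt with rfl | ht0
  · simp
  rcases ht1.eq_or_lt with rfl | ht1
  · simp
  have hP : 0 < p.1 + κ := by linarith
  have hQ : 0 < q.1 + κ := by linarith
  have hs : 0 < 1 - t := by linarith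
  rcases aux_real n hn z a b ha1 hb1 f L δ κ p hP with h | ⟨u, hu⟩
  · rw [h, EReal.coe_mul_bot_of_pos ht0, EReal.bot_add]; exact bot_le
  rcases aux_real n hn z a b ha1 hb1 f L δ κ q hQ with h | ⟨v, hv⟩
  · rw [h, EReal.coe_mul_bot_of_pos hs, EReal.add_bot]; exact bot_le
  rw [aux_eq n z a b f L δ κ p u hu, aux_eq n z a b f L δ κ q v hv]
  have h1 : (t • p + (1 - t) • q).1 = t * p.1 + (1 - t) * q.1 := by simp
  have h2 : (t • p + (1 - t) • q).2 = t * p.2 + (1 - t) * q.2 := by simp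
  have hM : 0 < (t * p.1 + (1 - t) * q.1) + κ := by
    have := mul_pos ht0 hp
    have := mul_pos hs hq
    linarith
  have key := aux_lower n z a b f L δ κ (t • p + (1 - t) • q) (by rw [h1]; exact hM.le)
    (fun i => (t * (p.1 + κ) * u i + (1 - t) * (q.1 + κ) * v i)
      / ((t * p.1 + (1 - t) * q.1) + κ)) (by
      intro i
      rw [h1, h2]
      refine iSup_le fun x => EReal.coe_le_coe_iff.2 ?_
      have e1 := aux_ge a b f (-(L (z i) + p.2) / (p.1 + κ)) x x.2.1 x.2.2
      have e2 := aux_ge a b f (-(L (z i) + q.2) / (q.1 + κ)) x x.2.1 x.2.2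
      rw [hu, EReal.coe_le_coe_iff] at e1
      rw [hv, EReal.coe_le_coe_iff] at e2
      have e1' := mul_le_mul_of_nonneg_left e1 (mul_pos ht0 hP).le
      have e2' := mul_le_mul_of_nonneg_left e2 (mul_pos hs hQ).le
      rw [le_div_iff₀ hM]
      refine le_trans (le_of_eq ?_) (add_le_add e1' e2')
      field_simp
      ring)
  refine le_trans (le_of_eq ?_) key
  rw [h1, h2, ← EReal.coe_mul, ← EReal.coe_mul, ← EReal.coe_add]
  congr 1
  rw [← Finset.sum_div, Finset.sum_add_distrib, ← Finset.mul_sum, ← Finset.mul_sum]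
  have : (n : ℝ) ≠ 0 := by positivity
  field_simp
  ring
end

section
/- Let ℒ : 𝒵 → ℝ be measurable, let P_n be the empirical distribution of points z_1, …, z_n ∈ 𝒵, and let δ > 0, κ ≥ 0. Then the function λ ↦ −λδ − (λ + κ) log E_{P_n}[ exp( −ℒ/(λ + κ) ) ] is concave on (0,∞). -/
open MeasureTheory Classical
open scoped ENNReal BigOperators

/-- The KL dual objective
`λ ↦ −λδ − (λ+κ) log E_{Pₙ}[exp(−ℒ/(λ+κ))]`,
with `E_{Pₙ}[g] = (1/n) ∑ᵢ g(zᵢ)` the expectation under the empirical distribution of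
`z₁, …, zₙ`, is concave on `(0,∞)`. -/
theorem dual_objective_concave_KL
    {𝒵 : Type*} [MeasurableSpace 𝒵] (n : ℕ) (hn : 0 < n) (z : Fin n → 𝒵)
    (L : 𝒵 → ℝ) (hL : Measurable L)
    (δ : ℝ) (hδ : 0 < δ) (κ : ℝ) (hκ : 0 ≤ κ) :
    ConcaveOn ℝ (Set.Ioi (0 : ℝ))
      (fun lam : ℝ => -(lam * δ) - (lam + κ) *
        Real.log ((n : ℝ)⁻¹ * ∑ i : Fin n, Real.exp (-(L (z i)) / (lam + κ)))) := by
  have hn' : (0 : ℝ) < n := by exact_mod_cast hn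
  have : Nonempty (Fin n) := ⟨⟨0, hn⟩⟩
  have hpos : ∀ r : ℝ, 0 < (n : ℝ)⁻¹ * ∑ i : Fin n, Real.exp (-(L (z i)) / r) := by
    intro r
    have : 0 < ∑ i : Fin n, Real.exp (-(L (z i)) / r) :=
      Finset.sum_pos (fun i _ => Real.exp_pos _) Finset.univ_nonempty
    positivity
  refine ⟨convex_Ioi 0, ?_⟩
  intro x hx y hy a b ha hb hab
  simp only [Set.mem_Ioi] at hx hy
  simp only [smul_eq_mul]
  obtain ⟨s, hs⟩ : ∃ s, s = x + κ := ⟨_, rfl⟩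
  obtain ⟨t, ht⟩ : ∃ t, t = y + κ := ⟨_, rfl⟩
  have hs0 : 0 < s := by linarith
  have ht0 : 0 < t := by linarith
  have hr : a * x + b * y + κ = a * s + b * t := by
    rw [hs, ht]; linear_combination (-κ) * hab
  have hr0 : 0 < a * s + b * t := by
    rcases ha.eq_or_lt with h | h
    · have : b = 1 := by linarith
      subst this; rw [← h]; linarith
    · have := mul_pos h hs0
      have := mul_nonneg hb ht0.le
      linarith
  rw [hr, ← hs, ← ht]
  obtain ⟨r, hrr⟩ : ∃ r, r = a * s + b * t := ⟨_, rfl⟩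
  rw [← hrr] at hr0 ⊢
  have hA := hpos s
  have hB := hpos t
  have hC := hpos r
  obtain ⟨A, hAd⟩ : ∃ A, A = (n : ℝ)⁻¹ * ∑ i : Fin n, Real.exp (-(L (z i)) / s) := ⟨_, rfl⟩
  obtain ⟨B, hBd⟩ : ∃ A, A = (n : ℝ)⁻¹ * ∑ i : Fin n, Real.exp (-(L (z i)) / t) := ⟨_, rfl⟩
  obtain ⟨C, hCd⟩ : ∃ A, A = (n : ℝ)⁻¹ * ∑ i : Fin n, Real.exp (-(L (z i)) / r) := ⟨_, rfl⟩
  rw [← hAd] at hA ⊢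
  rw [← hBd] at hB ⊢
  rw [← hCd] at hC ⊢
  have hw : a * s / r + b * t / r = 1 := by
    rw [← add_div, ← hrr, div_self hr0.ne']
  set c := a * s / r * Real.log A + b * t / r * Real.log B with hc
  have key : ∀ i : Fin n, Real.exp (-(L (z i)) / r) * Real.exp (-c) ≤
      a * s / r * (Real.exp (-(L (z i)) / s) / A) + b * t / r * (Real.exp (-(L (z i)) / t) / B) := by
    intro i
    have h := convexOn_exp.2 (Set.mem_univ (-(L (z i)) / s - Real.log A))
      (Set.mem_univ (-(L (z i)) / t - Real.log B))
      (show 0 ≤ a * s / r by positivity) (show 0 ≤ b * t / r by positivity) hw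
    simp only [smul_eq_mul, Real.exp_sub, Real.exp_log hA, Real.exp_log hB] at h
    rw [← Real.exp_add]
    refine le_of_eq_of_le ?_ h
    congr 1
    have e : -(L (z i)) / r = a * s / r * (-(L (z i)) / s) + b * t / r * (-(L (z i)) / t) := by
      field_simp
      linear_combination (L (z i)) * hab
    rw [e, hc]; ring
  have hsum : C * Real.exp (-c) ≤ 1 := by
    have h := Finset.sum_le_sum (fun i (_ : i ∈ Finset.univ) => key i)
    rw [← Finset.sum_mul, Finset.sum_add_distrib, ← Finset.mul_sum, ← Finset.mul_sum,
      ← Finset.sum_div, ← Finset.sum_div] at h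
    have h2 := mul_le_mul_of_nonneg_left h (inv_nonneg.2 hn'.le)
    calc C * Real.exp (-c) = _ := by rw [hCd, mul_assoc]
      _ ≤ _ := h2
      _ = a * s / r * (A / A) + b * t / r * (B / B) := by
        linear_combination (-(a * s / r / A)) * hAd - (b * t / r / B) * hBd
      _ = 1 := by rw [div_self hA.ne', div_self hB.ne', mul_one, mul_one, hw]
  have hlog : Real.log C ≤ c := by
    rw [Real.log_le_iff_le_exp hC]
    rwa [Real.exp_neg, ← div_eq_mul_inv, div_le_one (Real.exp_pos _)] at hsum
  have hfin := mul_le_mul_of_nonneg_left hlog hr0.le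
  have hrc : r * c = a * s * Real.log A + b * t * Real.log B := by
    rw [hc]; field_simp
  rw [hrc] at hfin
  linarith
end

section
/- Suppose T^x_{h_*(x),h_*(x)} > 0 for all x ∈ 𝒳 and f : (0,∞) → ℝ is convex with f(1) = 0 and f(0) := lim_{t→0+} f(t) finite. Then the clean-label distribution P_* is absolutely continuous with respect to the noisy-label distribution P_T, with Radon–Nikodym derivative dP_*/dP_T(x,y) = 1_{h_*(x) = y} / T^x_{h_*(x),h_*(x)}, and D_f(P_*‖P_T) = ∫ [ (1 − T^x_{h_*(x),h_*(x)}) f(0) + T^x_{h_*(x),h_*(x)} f(1 / T^x_{h_*(x),h_*(x)}) ] dP_𝒳(x). -/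
open MeasureTheory Classical
open scoped ENNReal BigOperators

theorem aux_ext {X Y : Type*} [MeasurableSpace X] [Fintype Y] [MeasurableSpace Y]
    [MeasurableSingletonClass Y] (μ ν : Measure (X × Y))
    (h : ∀ (A : Set X) (y : Y), MeasurableSet A → μ (A ×ˢ ({y} : Set Y)) = ν (A ×ˢ ({y} : Set Y))) :
    μ = ν := by
  ext S hS
  have hm : ∀ y : Y, MeasurableSet ((fun x : X => (x, y)) ⁻¹' S) := fun y =>
    measurable_prodMk_right hS
  have hU : S = ⋃ y : Y, ((fun x : X => (x, y)) ⁻¹' S) ×ˢ ({y} : Set Y) := by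
    ext ⟨x, y⟩
    simp
  have hd : Pairwise (Function.onFun Disjoint
      (fun y : Y => ((fun x : X => (x, y)) ⁻¹' S) ×ˢ ({y} : Set Y))) := by
    intro a b hab
    refine Set.disjoint_left.2 ?_
    rintro ⟨x, y⟩ h1 h2
    simp at h1 h2
    exact hab (h1.2.symm.trans h2.2)
  have hmm : ∀ y : Y, MeasurableSet (((fun x : X => (x, y)) ⁻¹' S) ×ˢ ({y} : Set Y)) :=
    fun y => (hm y).prod (measurableSet_singleton y)
  rw [hU, measure_iUnion hd hmm, measure_iUnion hd hmm]
  exact tsum_congr fun y => h _ y (hm y)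

theorem aux_cont_s8 (f : ℝ → ℝ) (hf_cvx : ConvexOn ℝ (Set.Ioi (0 : ℝ)) f)
    (hf0 : ContinuousWithinAt f (Set.Ioi (0 : ℝ)) 0) :
    Continuous (fun r : ℝ => f (max r 0)) := by
  have h1 : ContinuousOn f (Set.Ioi 0) := hf_cvx.continuousOn isOpen_Ioi
  have h2 : ContinuousOn f (Set.Ici 0) := by
    intro x hx
    rcases eq_or_lt_of_le (show (0:ℝ) ≤ x from hx) with h | h
    · subst h
      rw [← Set.Ioi_insert]
      exact continuousWithinAt_insert_self.2 hf0
    · exact (h1.continuousAt (Ioi_mem_nhds h)).continuousWithinAt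
  exact h2.comp_continuous (by fun_prop) (fun x => by simp)

theorem aux_nonneg (f : ℝ → ℝ) (hf_cvx : ConvexOn ℝ (Set.Ioi (0 : ℝ)) f) (hf1 : f 1 = 0)
    (hf0 : ContinuousWithinAt f (Set.Ioi (0 : ℝ)) 0) (t : ℝ) (ht : 0 < t) (ht1 : t ≤ 1) :
    0 ≤ (1 - t) * f 0 + t * f (1 / t) := by
  have hc := aux_cont_s8 f hf_cvx hf0
  have key : ∀ e : ℝ, 0 < e →
      f (max ((1 - t) * e + 1) 0) ≤ (1 - t) * f (max e 0) + t * f (1 / t) := by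
    intro e he
    have h := hf_cvx.2 (show e ∈ Set.Ioi (0:ℝ) from he)
      (show 1 / t ∈ Set.Ioi (0:ℝ) from by simpa using ht) (sub_nonneg.2 ht1) ht.le (by ring)
    simp only [smul_eq_mul] at h
    rw [mul_one_div_cancel ht.ne'] at h
    have : 0 ≤ (1 - t) * e := mul_nonneg (sub_nonneg.2 ht1) he.le
    rwa [max_eq_left (by linarith), max_eq_left he.le]
  have l1 : Filter.Tendsto (fun e : ℝ => f (max ((1 - t) * e + 1) 0)) (nhdsWithin 0 (Set.Ioi 0))
      (nhds (f (max ((1 - t) * 0 + 1) 0))) :=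
    ((hc.comp (g := fun r : ℝ => f (max r 0)) (f := fun e : ℝ => (1 - t) * e + 1)
      (by fun_prop)).tendsto 0).mono_left nhdsWithin_le_nhds
  have l2 : Filter.Tendsto (fun e : ℝ => (1 - t) * f (max e 0) + t * f (1 / t))
      (nhdsWithin 0 (Set.Ioi 0)) (nhds ((1 - t) * f (max 0 0) + t * f (1 / t))) :=
    (((hc.const_mul (1 - t)).add_const (t * f (1 / t))).tendsto 0).mono_left nhdsWithin_le_nhds
  have := le_of_tendsto_of_tendsto l1 l2
    (Filter.eventually_of_mem self_mem_nhdsWithin fun e he => key e he)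
  simpa [hf1] using this

/-- If `T^x_{h⋆(x),h⋆(x)} > 0` for all `x`, then `P⋆ ≪ P_T` with
`dP⋆/dP_T(x,y) = 1_{h⋆(x)=y} / T^x_{h⋆(x),h⋆(x)}`, and
`D_f(P⋆‖P_T) = ∫ [(1 − T^x_{h⋆(x),h⋆(x)}) f(0) + T^x_{h⋆(x),h⋆(x)} f(1/T^x_{h⋆(x),h⋆(x)})] dP_𝒳`. -/
theorem clean_vs_noisy_fDiv
    {𝒳 : Type*} [MeasurableSpace 𝒳]
    {𝒴 : Type*} [Fintype 𝒴] [MeasurableSpace 𝒴] [MeasurableSingletonClass 𝒴]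
    (PX : Measure 𝒳) [IsProbabilityMeasure PX]
    (hstar : 𝒳 → 𝒴) (hstar_meas : Measurable hstar)
    -- sample-dependent transition matrix
    (T : 𝒳 → 𝒴 → 𝒴 → ℝ)
    (hT_meas : ∀ y ytilde : 𝒴, Measurable fun x => T x y ytilde)
    (hT_nonneg : ∀ x y ytilde, 0 ≤ T x y ytilde)
    (hT_sum : ∀ x y, ∑ ytilde : 𝒴, T x y ytilde = 1)
    (hT_pos : ∀ x, 0 < T x (hstar x) (hstar x))
    -- the clean-label distribution P⋆
    (Pstar : Measure (𝒳 × 𝒴)) [IsProbabilityMeasure Pstar]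
    (hPstar : ∀ (A : Set 𝒳) (y : 𝒴), MeasurableSet A →
      Pstar (A ×ˢ ({y} : Set 𝒴)) = PX (A ∩ hstar ⁻¹' {y}))
    -- the noisy-label distribution P_T
    (PT : Measure (𝒳 × 𝒴)) [IsProbabilityMeasure PT]
    (hPT : ∀ (A : Set 𝒳) (y : 𝒴), MeasurableSet A →
      PT (A ×ˢ ({y} : Set 𝒴)) = ∫⁻ x in A, ENNReal.ofReal (T x (hstar x) y) ∂PX)
    -- convex f with f(1) = 0 and finite continuous extension at 0
    (f : ℝ → ℝ) (hf_cvx : ConvexOn ℝ (Set.Ioi (0 : ℝ)) f) (hf1 : f 1 = 0)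
    (hf0 : ContinuousWithinAt f (Set.Ioi (0 : ℝ)) 0) :
    Pstar ≪ PT ∧
    (Pstar.rnDeriv PT =ᵐ[PT] fun p : 𝒳 × 𝒴 =>
      ENNReal.ofReal (if hstar p.1 = p.2 then (T p.1 (hstar p.1) (hstar p.1))⁻¹ else 0)) ∧
    fDiv f Pstar PT =
      ((∫⁻ x, ENNReal.ofReal
          ((1 - T x (hstar x) (hstar x)) * f 0 +
            T x (hstar x) (hstar x) * f (1 / T x (hstar x) (hstar x))) ∂PX : ℝ≥0∞) : EReal) := by
  have hTh : ∀ y, Measurable fun x => T x (hstar x) y := by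
    intro y
    have : (fun x => T x (hstar x) y) = fun x => ∑ z : 𝒴, if hstar x = z then T x z y else 0 := by
      funext x
      simp
    rw [this]
    refine Finset.measurable_sum _ fun z _ => ?_
    exact Measurable.ite (hstar_meas (measurableSet_singleton z)) (hT_meas z y) measurable_const
  have hTd : Measurable fun x => T x (hstar x) (hstar x) := by
    have : (fun x => T x (hstar x) (hstar x))
        = fun x => ∑ z : 𝒴, if hstar x = z then T x (hstar x) z else 0 := by
      funext x
      simp
    rw [this]
    refine Finset.measurable_sum _ fun z _ => ?_
    exact Measurable.ite (hstar_meas (measurableSet_singleton z)) (hTh z) measurable_const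
  have hle : ∀ x y, T x (hstar x) y ≤ 1 := by
    intro x y
    rw [← hT_sum x (hstar x)]
    exact Finset.single_le_sum (f := fun z => T x (hstar x) z)
      (fun z _ => hT_nonneg _ _ _) (Finset.mem_univ y)
  have hDm : MeasurableSet {p : 𝒳 × 𝒴 | hstar p.1 = p.2} := by
    have : {p : 𝒳 × 𝒴 | hstar p.1 = p.2} = ⋃ y : 𝒴, (hstar ⁻¹' {y}) ×ˢ ({y} : Set 𝒴) := by
      ext ⟨x, y⟩
      simp [eq_comm]
    rw [this]
    exact MeasurableSet.iUnion fun y =>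
      (hstar_meas (measurableSet_singleton y)).prod (measurableSet_singleton y)
  set gr : 𝒳 × 𝒴 → ℝ := fun p =>
    if hstar p.1 = p.2 then (T p.1 (hstar p.1) (hstar p.1))⁻¹ else 0 with hgr
  have hgr_meas : Measurable gr :=
    Measurable.ite hDm (hTd.comp measurable_fst).inv measurable_const
  have hgr_nn : ∀ p, 0 ≤ gr p := by
    intro p
    simp only [hgr]
    split_ifs
    · exact inv_nonneg.2 (hT_nonneg _ _ _)
    · exact le_rfl
  set ν : 𝒴 → Measure 𝒳 := fun y =>
    PX.withDensity fun x => ENNReal.ofReal (T x (hstar x) y) with hν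
  have hPTeq : PT = ∑ y : 𝒴, (ν y).map (fun x => (x, y)) := by
    apply aux_ext
    intro A y hA
    rw [hPT A y hA, Measure.finsetSum_apply, Finset.sum_eq_single y]
    · rw [Measure.map_apply measurable_prodMk_right (hA.prod (measurableSet_singleton y))]
      have : (fun x : 𝒳 => (x, y)) ⁻¹' (A ×ˢ ({y} : Set 𝒴)) = A := by ext x; simp
      rw [this, hν, withDensity_apply _ hA]
    · intro b _ hb
      rw [Measure.map_apply measurable_prodMk_right (hA.prod (measurableSet_singleton y))]
      have : (fun x : 𝒳 => (x, b)) ⁻¹' (A ×ˢ ({y} : Set 𝒴)) = ∅ := by ext x; simp [hb]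
      rw [this, measure_empty]
    · simp
  have hPsEq : Pstar = PT.withDensity fun p => ENNReal.ofReal (gr p) := by
    apply aux_ext
    intro A y hA
    have hAy := hA.prod (measurableSet_singleton y)
    rw [hPstar A y hA, withDensity_apply _ hAy, ← lintegral_indicator hAy, hPTeq,
      lintegral_finsetSum_measure, Finset.sum_eq_single y]
    · rw [lintegral_map (hgr_meas.ennreal_ofReal.indicator hAy) measurable_prodMk_right, hν,
        lintegral_withDensity_eq_lintegral_mul _ (hTh y).ennreal_ofReal
          (g := fun a => (A ×ˢ ({y} : Set 𝒴)).indicator (fun p => ENNReal.ofReal (gr p)) (a, y))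
          ((hgr_meas.ennreal_ofReal.indicator hAy).comp measurable_prodMk_right),
        ← lintegral_indicator_one (hA.inter (hstar_meas (measurableSet_singleton y)))]
      refine lintegral_congr fun x => ?_
      by_cases hx : x ∈ A <;> by_cases hy : hstar x = y
      · subst hy
        simp [hx, hgr, Set.indicator]
        rw [← ENNReal.ofReal_mul (hT_nonneg _ _ _), mul_inv_cancel₀ (hT_pos x).ne']
        simp
      · simp [hx, hy, hgr, Set.indicator]
      · simp [hx, hy, hgr, Set.indicator]
      · simp [hx, hy, hgr, Set.indicator]
    · intro b _ hb
      rw [lintegral_map (hgr_meas.ennreal_ofReal.indicator hAy) measurable_prodMk_right]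
      simp [Set.indicator, hb]
    · simp
  have hac : Pstar ≪ PT := by
    rw [hPsEq]
    exact withDensity_absolutelyContinuous _ _
  have hrn : Pstar.rnDeriv PT =ᵐ[PT] fun p => ENNReal.ofReal (gr p) := by
    have := Measure.rnDeriv_withDensity PT hgr_meas.ennreal_ofReal
    rwa [← hPsEq] at this
  refine ⟨hac, hrn, ?_⟩
  have hcont := aux_cont_s8 f hf_cvx hf0
  have hfg : Measurable fun p => f (gr p) := by
    have := hcont.measurable.comp hgr_meas
    convert this using 2 with p
    simp [hgr_nn p]
  have hae : (fun p => f ((Pstar.rnDeriv PT) p).toReal) =ᵐ[PT] fun p => f (gr p) := by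
    filter_upwards [hrn] with p hp
    rw [hp, ENNReal.toReal_ofReal (hgr_nn p)]
  set G : 𝒳 → ℝ := fun x => (1 - T x (hstar x) (hstar x)) * f 0 +
            T x (hstar x) (hstar x) * f (1 / T x (hstar x) (hstar x)) with hG
  have hG_nn : ∀ x, 0 ≤ G x := fun x =>
    aux_nonneg f hf_cvx hf1 hf0 _ (hT_pos x) (hle x _)
  have hG_sum : ∀ x, ∑ y, T x (hstar x) y * f (gr (x, y)) = G x := by
    intro x
    have : ∀ y, T x (hstar x) y * f (gr (x, y)) = T x (hstar x) y * f 0 +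
        if hstar x = y then T x (hstar x) (hstar x) *
          (f (1 / T x (hstar x) (hstar x)) - f 0) else 0 := by
      intro y
      by_cases hy : hstar x = y
      · simp only [hgr, if_pos hy, one_div]
        rw [← hy]
        ring
      · simp [hgr, hy]
    simp_rw [this]
    rw [Finset.sum_add_distrib, ← Finset.sum_mul, hT_sum, Finset.sum_ite_eq,
      if_pos (Finset.mem_univ _), hG]
    ring
  have hterm_meas : ∀ y, Measurable fun x => T x (hstar x) y * f (gr (x, y)) := fun y =>
    (hTh y).mul (hfg.comp measurable_prodMk_right)
  have hG_meas : Measurable G := by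
    have : G = fun x => ∑ y, T x (hstar x) y * f (gr (x, y)) := by
      funext x
      rw [hG_sum]
    rw [this]
    exact Finset.measurable_sum _ fun y _ => hterm_meas y
  have hmapI : ∀ y, Integrable (fun p => f (gr p)) ((ν y).map (fun x => (x, y))) ↔
      Integrable (fun x => T x (hstar x) y * f (gr (x, y))) PX := by
    intro y
    rw [integrable_map_measure hfg.aestronglyMeasurable measurable_prodMk_right.aemeasurable, hν,
      integrable_withDensity_iff_integrable_smul' (hTh y).ennreal_ofReal
        (Filter.Eventually.of_forall fun x => ENNReal.ofReal_lt_top)]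
    simp [ENNReal.toReal_ofReal (hT_nonneg _ _ _)]
  have hmapE : ∀ y, ∫ p, f (gr p) ∂((ν y).map (fun x => (x, y))) =
      ∫ x, T x (hstar x) y * f (gr (x, y)) ∂PX := by
    intro y
    rw [integral_map measurable_prodMk_right.aemeasurable hfg.aestronglyMeasurable, hν,
      integral_withDensity_eq_integral_toReal_smul (hTh y).ennreal_ofReal
        (Filter.Eventually.of_forall fun x => ENNReal.ofReal_lt_top)]
    simp [ENNReal.toReal_ofReal (hT_nonneg _ _ _)]
  have hPTI : Integrable (fun p => f (gr p)) PT ↔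
      ∀ y, Integrable (fun x => T x (hstar x) y * f (gr (x, y))) PX := by
    rw [hPTeq, integrable_finsetSum_measure]
    simp [hmapI]
  have hGI : Integrable (fun p => f (gr p)) PT ↔ Integrable G PX := by
    rw [hPTI]
    constructor
    · intro h
      have := integrable_finsetSum Finset.univ fun y _ => h y
      refine this.congr (Filter.Eventually.of_forall fun x => ?_)
      simpa using hG_sum x
    · intro h y
      refine (h.add (integrable_const |f 0|)).mono' (hterm_meas y).aestronglyMeasurable
        (Filter.Eventually.of_forall fun x => ?_)
      have h0 := hG_nn x
      by_cases hy : hstar x = y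
      · have e : T x (hstar x) y * f (gr (x, y)) =
            G x - (1 - T x (hstar x) (hstar x)) * f 0 := by
          simp only [hgr, if_pos hy, hG, one_div]
          rw [← hy]
          ring
        have b : |(1 - T x (hstar x) (hstar x)) * f 0| ≤ |f 0| := by
          rw [abs_mul]
          refine mul_le_of_le_one_left (abs_nonneg _) ?_
          rw [abs_of_nonneg (sub_nonneg.2 (hle x _))]
          linarith [hT_pos x]
        rw [Real.norm_eq_abs, e]
        refine (abs_sub _ _).trans ?_
        rw [abs_of_nonneg h0]
        exact add_le_add le_rfl b
      · have e : gr (x, y) = 0 := by simp [hgr, hy]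
        rw [Real.norm_eq_abs, e, abs_mul, abs_of_nonneg (hT_nonneg _ _ _)]
        have := mul_le_of_le_one_left (abs_nonneg (f 0)) (hle x y)
        simp only [Pi.add_apply]
        linarith
  unfold fDiv
  rw [integrable_congr hae, integral_congr_ae hae]
  by_cases hI : Integrable G PX
  · have hI' := hGI.2 hI
    rw [if_pos ⟨hac, hI'⟩]
    have hint : ∫ p, f (gr p) ∂PT = ∫ x, G x ∂PX := by
      have hI2 := hPTI.1 hI'
      rw [hPTeq, integral_finsetSum_measure fun y _ => (hmapI y).2 (hI2 y)]
      simp_rw [hmapE]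
      rw [← integral_finsetSum _ fun y _ => hI2 y]
      simp_rw [hG_sum]
    rw [hint, ← ofReal_integral_eq_lintegral_ofReal hI (Filter.Eventually.of_forall hG_nn),
      EReal.coe_ennreal_ofReal, max_eq_left (integral_nonneg hG_nn)]
  · rw [if_neg fun h => hI (hGI.1 h.2)]
    have : ∫⁻ x, ENNReal.ofReal (G x) ∂PX = ⊤ := by
      by_contra hne
      exact hI ((lintegral_ofReal_ne_top_iff_integrable hG_meas.aestronglyMeasurable
        (Filter.Eventually.of_forall hG_nn)).1 hne)
    rw [this]
    rfl
end

section
/- Let f : (0,∞) → ℝ be strictly convex and continuously differentiable with f(0) := lim_{t→0+} f(t) finite. Then the function g(r) := r f(0) + (1 − r) f(1/(1 − r)) is strictly increasing on [0,1): its derivative is g'(r) = f(0) − f(z) + z f'(z) with z := 1/(1 − r), and g'(r) > 0 for all r ∈ [0,1). -/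
open Classical
open scoped BigOperators

/-- For strictly convex, continuously differentiable `f : (0,∞) → ℝ` with
finite limit `f(0)` at `0`, the function `g(r) = r f(0) + (1−r) f(1/(1−r))` is strictly
increasing on `[0,1)`, with derivative `g'(r) = f(0) − f(z) + z f'(z)` for `z = 1/(1−r)`,
and `g'(r) > 0` on `[0,1)`. -/
theorem forgetting_budget_strictly_increasing
    (f f' : ℝ → ℝ)
    (hf_cvx : StrictConvexOn ℝ (Set.Ioi (0 : ℝ)) f)
    (hf_deriv : ∀ x ∈ Set.Ioi (0 : ℝ), HasDerivAt f (f' x) x)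
    (hf'_cont : ContinuousOn f' (Set.Ioi (0 : ℝ)))
    (hf0 : ContinuousWithinAt f (Set.Ioi (0 : ℝ)) 0) :
    StrictMonoOn (fun r : ℝ => r * f 0 + (1 - r) * f (1 / (1 - r))) (Set.Ico 0 1) ∧
    (∀ r ∈ Set.Ico (0 : ℝ) 1,
      HasDerivAt (fun r : ℝ => r * f 0 + (1 - r) * f (1 / (1 - r)))
        (f 0 - f (1 / (1 - r)) + (1 / (1 - r)) * f' (1 / (1 - r))) r) ∧
    (∀ r ∈ Set.Ico (0 : ℝ) 1,
      0 < f 0 - f (1 / (1 - r)) + (1 / (1 - r)) * f' (1 / (1 - r))) := by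
  have slp : ∀ x y : ℝ, 0 < x → x < y → f y - f x < (y - x) * f' y := by
    intro x y hx hxy
    have hy : 0 < y := hx.trans hxy
    have h := hf_cvx.slope_lt_of_hasDerivAt (Set.mem_Ioi.2 hx) (Set.mem_Ioi.2 hy) hxy
      (hf_deriv y hy)
    rw [slope_def_field, div_lt_iff₀ (sub_pos.2 hxy)] at h
    linarith
  have slp2 : ∀ x y : ℝ, 0 < x → x < y → (y - x) * f' x < f y - f x := by
    intro x y hx hxy
    have hy : 0 < y := hx.trans hxy
    have h := hf_cvx.lt_slope_of_hasDerivAt (Set.mem_Ioi.2 hx) (Set.mem_Ioi.2 hy) hxy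
      (hf_deriv x hx)
    rw [slope_def_field, lt_div_iff₀ (sub_pos.2 hxy)] at h
    linarith
  have key : ∀ z : ℝ, 0 < z → 0 < f 0 - f z + z * f' z := by
    intro z hz
    have hw : 0 < z / 2 := by linarith
    have hwz : z / 2 < z := by linarith
    have h1 := slp (z / 2) z hw hwz
    have h2 := slp2 (z / 2) z hw hwz
    have h3 : f (z / 2) - (z / 2 - 0) * f' (z / 2) ≤ f 0 := by
      have hl : Filter.Tendsto (fun x : ℝ => f (z / 2) - (z / 2 - x) * f' (z / 2))
          (nhdsWithin 0 (Set.Ioi 0)) (nhds (f (z / 2) - (z / 2 - 0) * f' (z / 2))) := by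
        have hc : Continuous (fun x : ℝ => f (z / 2) - (z / 2 - x) * f' (z / 2)) := by
          fun_prop
        exact (hc.tendsto 0).mono_left nhdsWithin_le_nhds
      refine le_of_tendsto_of_tendsto hl hf0 ?_
      filter_upwards [Ioo_mem_nhdsGT hw] with x hx
      have := slp x (z / 2) hx.1 hx.2
      linarith
    nlinarith
  have hder : ∀ r ∈ Set.Ico (0 : ℝ) 1,
      HasDerivAt (fun r : ℝ => r * f 0 + (1 - r) * f (1 / (1 - r)))
        (f 0 - f (1 / (1 - r)) + (1 / (1 - r)) * f' (1 / (1 - r))) r := by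
    intro r hr
    have hp : 0 < 1 - r := sub_pos.2 hr.2
    have hs : HasDerivAt (fun r : ℝ => 1 - r) (-1) r := by
      simpa using (hasDerivAt_id r).const_sub 1
    have hi : HasDerivAt (fun r : ℝ => 1 / (1 - r)) (1 / (1 - r) ^ 2) r := by
      simpa [one_div] using hs.fun_inv hp.ne'
    have hc := HasDerivAt.comp r (hf_deriv (1 / (1 - r)) (one_div_pos.2 hp)) hi
    have := ((hasDerivAt_id r).mul_const (f 0)).add (hs.mul hc)
    refine HasDerivAt.congr_deriv (f := fun r : ℝ => r * f 0 + (1 - r) * f (1 / (1 - r))) this ?_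
    simp only [Function.comp]
    field_simp
    ring
  have hpos : ∀ r ∈ Set.Ico (0 : ℝ) 1,
      0 < f 0 - f (1 / (1 - r)) + (1 / (1 - r)) * f' (1 / (1 - r)) :=
    fun r hr => key _ (one_div_pos.2 (sub_pos.2 hr.2))
  refine ⟨?_, hder, hpos⟩
  refine strictMonoOn_of_deriv_pos (convex_Ico 0 1)
    (fun r hr => (hder r hr).continuousAt.continuousWithinAt) ?_
  intro r hr
  have hr' := interior_subset hr
  rw [(hder r hr').deriv]
  exact hpos r hr'
end

section
/- Let α > 1 and define f_α : (0,∞) → ℝ by f_α(t) := (t^α − 1)/(α(α − 1)). Then the Legendre transform of f_α is given, for all t ∈ ℝ, by f_α*(t) = α^{−1} (α − 1)^{α/(α−1)} max(t, 0)^{α/(α−1)} + (α(α − 1))^{−1}. In particular, f_α* is constant equal to 1/(α(α−1)) on (−∞, 0) and finite on all of ℝ. -/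
open Classical
open scoped BigOperators

/-- The α-divergence generator `f_α(t) = (t^α − 1)/(α(α−1))`. -/
noncomputable def alphaGen (α t : ℝ) : ℝ := (t ^ α - 1) / (α * (α - 1))

/-- The Legendre transform `f_α*(t) = sup_{x>0} {tx − f_α(x)}` of the α-divergence
generator, valued in the extended reals. -/
noncomputable def alphaGenStar (α t : ℝ) : EReal :=
  ⨆ x : {x : ℝ // 0 < x}, ((t * (x : ℝ) - alphaGen α x : ℝ) : EReal)

/-- For `α > 1`, the Legendre transform of `f_α(t) = (t^α − 1)/(α(α−1))`
is `f_α*(t) = α⁻¹ (α−1)^{α/(α−1)} max(t,0)^{α/(α−1)} + (α(α−1))⁻¹` for all `t ∈ ℝ`;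
in particular it is constant equal to `1/(α(α−1))` on `(−∞,0)` and finite on all of `ℝ`. -/
theorem legendre_transform_alpha_divergence (α : ℝ) (hα : 1 < α) :
    (∀ t : ℝ, alphaGenStar α t =
      ((α⁻¹ * (α - 1) ^ (α / (α - 1)) * (max t 0) ^ (α / (α - 1)) +
        (α * (α - 1))⁻¹ : ℝ) : EReal)) ∧
    (∀ t : ℝ, t < 0 → alphaGenStar α t = (((α * (α - 1))⁻¹ : ℝ) : EReal)) ∧
    (∀ t : ℝ, alphaGenStar α t ≠ ⊤) := by
  have h1 : 0 < α - 1 := by linarith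
  have h0 : 0 < α := by linarith
  have hβ : α / (α - 1) ≠ 0 := (div_pos h0 h1).ne'
  have main : ∀ t : ℝ, alphaGenStar α t =
      ((α⁻¹ * (α - 1) ^ (α / (α - 1)) * (max t 0) ^ (α / (α - 1)) +
        (α * (α - 1))⁻¹ : ℝ) : EReal) := by
    intro t
    have hm : 0 ≤ max t 0 := le_max_right _ _
    unfold alphaGenStar
    apply le_antisymm
    · apply iSup_le
      rintro ⟨x, hx⟩
      rw [EReal.coe_le_coe_iff]
      have hpq : α.HolderConjugate (α / (α - 1)) := Real.HolderConjugate.conjExponent hα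
      have hy := Real.young_inequality_of_nonneg hx.le (mul_nonneg h1.le hm) hpq
      rw [Real.mul_rpow h1.le hm] at hy
      have hle : t * x ≤ max t 0 * x := mul_le_mul_of_nonneg_right (le_max_left _ _) hx.le
      have hy2 := div_le_div_of_nonneg_right hy h1.le
      simp only [alphaGen]
      generalize (α - 1) ^ (α / (α - 1)) = A at *
      generalize (max t 0) ^ (α / (α - 1)) = B at *
      have e1 : x * ((α - 1) * max t 0) / (α - 1) = max t 0 * x := by field_simp
      have e2 : (x ^ α / α + A * B / (α / (α - 1))) / (α - 1)
          = α⁻¹ * A * B + (α * (α - 1))⁻¹ + (x ^ α - 1) / (α * (α - 1)) := by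
        field_simp
        ring
      rw [e1, e2] at hy2
      linarith
    · rcases le_or_gt t 0 with ht | ht
      · rw [max_eq_right ht, Real.zero_rpow hβ, mul_zero, zero_add]
        have hc : Continuous (fun x : ℝ => t * x - alphaGen α x) := by
          unfold alphaGen
          have := Real.continuous_rpow_const h0.le
          fun_prop
        have hl : Filter.Tendsto (fun x : ℝ => ((t * x - alphaGen α x : ℝ) : EReal))
            (nhdsWithin 0 (Set.Ioi 0)) (nhds (((α * (α - 1))⁻¹ : ℝ) : EReal)) := by
          have h := (continuous_coe_real_ereal.comp hc).tendsto 0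
          have e : t * 0 - alphaGen α 0 = (α * (α - 1))⁻¹ := by
            simp only [alphaGen]
            rw [Real.zero_rpow h0.ne']
            ring
          simp only [Function.comp_def] at h
          rw [e] at h
          exact h.mono_left nhdsWithin_le_nhds
        refine le_of_tendsto hl ?_
        filter_upwards [self_mem_nhdsWithin] with x hx
        exact le_iSup (fun x : {x : ℝ // 0 < x} =>
          ((t * (x : ℝ) - alphaGen α x : ℝ) : EReal)) ⟨x, hx⟩
      · have hs : 0 < (α - 1) * t := mul_pos h1 ht
        refine le_trans (le_of_eq ?_) (le_iSup (fun x : {x : ℝ // 0 < x} =>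
          ((t * (x : ℝ) - alphaGen α x : ℝ) : EReal))
          ⟨((α - 1) * t) ^ (1 / (α - 1)), Real.rpow_pos_of_pos hs _⟩)
        rw [EReal.coe_eq_coe_iff, max_eq_left ht.le, mul_assoc, ← Real.mul_rpow h1.le ht.le]
        simp only [alphaGen]
        rw [← Real.rpow_mul hs.le]
        have e1 : 1 / (α - 1) * α = α / (α - 1) := by ring
        have e2 : α / (α - 1) = 1 + 1 / (α - 1) := by field_simp; ring
        rw [e1, e2, Real.rpow_add hs, Real.rpow_one]
        generalize ((α - 1) * t) ^ (1 / (α - 1)) = X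
        field_simp
        ring
  refine ⟨main, ?_, ?_⟩
  · intro t ht
    rw [main, max_eq_right ht.le, Real.zero_rpow hβ, mul_zero, zero_add]
  · intro t
    rw [main]
    exact EReal.coe_ne_top _
end
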